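/- arXiv:1511.07406 — 3 statements merged into one kernel-verified Lean document; each statement's English description precedes it below -/
import Mathlib

section
/- Brockett flow: let A = diag(a_ℓ) be a bounded diagonal operator in the basis (e_n) with (a_ℓ) a non-increasing sequence of nonnegative reals such that for every ℓ, inf_{j≠ℓ} |a_j − a_ℓ| > 0. Then for every H₀ ∈ S₂(H) the Cauchy problem H' = [H, [H, A]], H(0) = H₀ admits a unique global solution H ∈ C¹([0,∞), S₂(H)) which converges weakly in S₂(H) (and strongly as an operator) as t → +∞ to a diagonal Hilbert–Schmidt operator. -/
open MeasureTheory Filter Set ContinuousLinearMap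
open scoped RealInnerProductSpace

/-! ### Global solutions of ordinary differential equations -/

/-- An autonomous ODE with a bounded, globally Lipschitz vector field has a global solution. -/
lemma exists_hasDerivAt_of_bounded_lipschitz {E : Type*} [NormedAddCommGroup E] [NormedSpace ℝ E]
    [CompleteSpace E] {v : E → E} {K : NNReal} (hv : LipschitzWith K v) {L : NNReal}
    (hL : ∀ x, ‖v x‖ ≤ L) (x₀ : E) :
    ∃ u : ℝ → E, u 0 = x₀ ∧ ∀ t, HasDerivAt u (v (u t)) t := by
  have hloc : ∀ n : ℕ, ∃ u : ℝ → E, u 0 = x₀ ∧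
      ∀ t ∈ Ioo (-(n + 1 : ℝ)) (n + 1), HasDerivAt u (v (u t)) t := by
    intro n
    have h0 : (0 : ℝ) ∈ Icc (-(n + 1 : ℝ)) (n + 1) := by constructor <;> linarith
    have hPL : IsPicardLindelof (fun _ => v) (⟨0, h0⟩ : Icc (-(n + 1 : ℝ)) (n + 1)) x₀
        (L * (n + 1)) 0 L K :=
      { lipschitzOnWith := fun _ _ => hv.lipschitzOnWith
        continuousOn := fun _ _ => continuousOn_const
        norm_le := fun _ _ x _ => hL x
        mul_max_le := by simp }
    obtain ⟨u, hu0, hu⟩ := hPL.exists_eq_forall_mem_Icc_hasDerivWithinAt₀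
    exact ⟨u, hu0, fun t ht => (hu t (Ioo_subset_Icc_self ht)).hasDerivAt (Icc_mem_nhds ht.1 ht.2)⟩
  choose u hu0 hu using hloc
  have hagree : ∀ m n : ℕ, m ≤ n → EqOn (u m) (u n) (Ioo (-(m + 1 : ℝ)) (m + 1)) := by
    intro m n hmn
    have hmn' : (m : ℝ) ≤ n := by exact_mod_cast hmn
    refine ODE_solution_unique_of_mem_Ioo (v := fun _ => v) (s := fun _ => univ) (K := K) (t₀ := 0)
      (fun _ _ => hv.lipschitzOnWith) ⟨by linarith [m.cast_nonneg (α := ℝ)], by positivity⟩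
      (fun t ht => ⟨hu m t ht, trivial⟩) (fun t ht => ⟨hu n t ?_, trivial⟩)
      ((hu0 m).trans (hu0 n).symm)
    exact ⟨by linarith [ht.1], by linarith [ht.2]⟩
  refine ⟨fun t => u ⌈|t|⌉₊ t, hu0 _, fun t => ?_⟩
  have hmem : ∀ {s : ℝ} {n : ℕ}, |s| < n + 1 → s ∈ Ioo (-(n + 1 : ℝ)) (n + 1) :=
    fun h => abs_lt.mp h
  have hceil : ∀ s : ℝ, |s| < (⌈|s|⌉₊ : ℝ) + 1 := fun s =>
    (Nat.le_ceil _).trans_lt (lt_add_one _)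
  set n := ⌈|t|⌉₊ with hn
  have heq : (fun s => u ⌈|s|⌉₊ s) =ᶠ[nhds t] u n := by
    filter_upwards [Ioo_mem_nhds (hmem (hceil t)).1 (hmem (hceil t)).2] with s hs
    rcases le_total ⌈|s|⌉₊ n with h | h
    · exact hagree _ _ h (hmem (hceil s))
    · exact (hagree _ _ h hs).symm
  exact (hu n t (hmem (hceil t))).congr_of_eventuallyEq heq

/-- The radial retraction of a normed space onto its closed unit ball. -/
noncomputable def unitBallRetraction {E : Type*} [NormedAddCommGroup E] [NormedSpace ℝ E] (x : E) :
    E := (max 1 ‖x‖)⁻¹ • x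

section unitBallRetraction

variable {E : Type*} [NormedAddCommGroup E] [NormedSpace ℝ E]

lemma norm_unitBallRetraction_le (x : E) : ‖unitBallRetraction x‖ ≤ 1 := by
  have h : 0 < max 1 ‖x‖ := lt_max_of_lt_left one_pos
  rw [unitBallRetraction, norm_smul, norm_inv, Real.norm_of_nonneg h.le, inv_mul_le_one₀ h]
  exact le_max_right _ _

lemma unitBallRetraction_of_norm_le {x : E} (hx : ‖x‖ ≤ 1) : unitBallRetraction x = x := by
  simp [unitBallRetraction, max_eq_left hx]

lemma norm_unitBallRetraction_sub_le (x y : E) :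
    ‖unitBallRetraction x - unitBallRetraction y‖ ≤ 2 * ‖x - y‖ := by
  set m := max 1 ‖x‖ with hm
  have hm1 : 1 ≤ m := le_max_left _ _
  have hn1 : 1 ≤ max 1 ‖y‖ := le_max_left _ _
  have hmn : |max 1 ‖y‖ - m| ≤ ‖x - y‖ := by
    rw [abs_sub_comm]
    refine (abs_max_sub_max_le_max _ _ _ _).trans ?_
    simpa using abs_norm_sub_norm_le x y
  have hsplit : unitBallRetraction x - unitBallRetraction y
      = m⁻¹ • (x - y) + (m⁻¹ * (max 1 ‖y‖ - m)) • unitBallRetraction y := by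
    have h : (m⁻¹ * (max 1 ‖y‖ - m)) * (max 1 ‖y‖)⁻¹ = m⁻¹ - (max 1 ‖y‖)⁻¹ := by
      field_simp
    rw [unitBallRetraction, unitBallRetraction, smul_smul, h]
    module
  have hmi : ‖m⁻¹‖ ≤ 1 := by
    rw [norm_inv, Real.norm_of_nonneg (by linarith)]; exact inv_le_one_of_one_le₀ hm1
  rw [hsplit, two_mul]
  refine norm_add_le_of_le ?_ ?_
  · rw [norm_smul]; exact mul_le_of_le_one_left (norm_nonneg _) hmi
  · rw [norm_smul, norm_mul, Real.norm_eq_abs (_ - _)]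
    calc ‖m⁻¹‖ * |max 1 ‖y‖ - m| * ‖unitBallRetraction y‖ ≤ 1 * ‖x - y‖ * 1 := by
          gcongr; exact norm_unitBallRetraction_le y
      _ = ‖x - y‖ := by ring

end unitBallRetraction

/-- `f` is bounded and Lipschitz on `s`. -/
def BoundedLipschitzOn {E F : Type*} [NormedAddCommGroup E] [NormedAddCommGroup F]
    (f : E → F) (s : Set E) : Prop :=
  ∃ C : NNReal, (∀ x ∈ s, ‖f x‖ ≤ C) ∧ ∀ x ∈ s, ∀ y ∈ s, ‖f x - f y‖ ≤ C * ‖x - y‖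

namespace BoundedLipschitzOn

variable {E F : Type*} [NormedAddCommGroup E]

lemma id_closedBall (R : NNReal) :
    BoundedLipschitzOn (fun x : E => x) (Metric.closedBall 0 R) := by
  refine ⟨R + 1, fun x hx => ?_, fun x _ y _ => ?_⟩
  · rw [mem_closedBall_zero_iff] at hx
    push_cast; linarith
  · push_cast; nlinarith [norm_nonneg (x - y), R.coe_nonneg]

lemma const [NormedAddCommGroup F] (c : F) (s : Set E) : BoundedLipschitzOn (fun _ => c) s :=
  ⟨‖c‖₊, by simp, fun x _ y _ => by simp; positivity⟩

lemma sub [NormedAddCommGroup F] {f g : E → F} {s : Set E} (hf : BoundedLipschitzOn f s)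
    (hg : BoundedLipschitzOn g s) : BoundedLipschitzOn (fun x => f x - g x) s := by
  obtain ⟨C, hC, hC'⟩ := hf
  obtain ⟨D, hD, hD'⟩ := hg
  refine ⟨C + D, fun x hx => norm_sub_le_of_le (hC x hx) (hD x hx), fun x hx y hy => ?_⟩
  rw [sub_sub_sub_comm, NNReal.coe_add, add_mul]
  exact norm_sub_le_of_le (hC' x hx y hy) (hD' x hx y hy)

lemma mul [NormedRing F] {f g : E → F} {s : Set E} (hf : BoundedLipschitzOn f s)
    (hg : BoundedLipschitzOn g s) : BoundedLipschitzOn (fun x => f x * g x) s := by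
  obtain ⟨C, hC, hC'⟩ := hf
  obtain ⟨D, hD, hD'⟩ := hg
  refine ⟨2 * C * D, fun x hx => ?_, fun x hx y hy => ?_⟩
  · refine (norm_mul_le_of_le (hC x hx) (hD x hx)).trans ?_
    push_cast
    nlinarith [mul_nonneg C.coe_nonneg D.coe_nonneg]
  · have h : f x * g x - f y * g y = f x * (g x - g y) + (f x - f y) * g y := by noncomm_ring
    rw [h]
    refine (norm_add_le_of_le (norm_mul_le_of_le (hC x hx) (hD' x hx y hy))
      (norm_mul_le_of_le (hC' x hx y hy) (hD y hy))).trans (le_of_eq ?_)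
    push_cast; ring

lemma star [NormedRing F] [StarRing F] [NormedStarGroup F] {f : E → F} {s : Set E}
    (hf : BoundedLipschitzOn f s) : BoundedLipschitzOn (fun x => star (f x)) s := by
  obtain ⟨C, hC, hC'⟩ := hf
  refine ⟨C, fun x hx => by simpa using hC x hx, fun x hx y hy => ?_⟩
  rw [← star_sub, norm_star]
  exact hC' x hx y hy

lemma lipschitzOnWith [NormedAddCommGroup F] {f : E → F} {s : Set E}
    (hf : BoundedLipschitzOn f s) : ∃ C : NNReal, LipschitzOnWith C f s := by
  obtain ⟨C, -, hC⟩ := hf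
  refine ⟨C, LipschitzOnWith.of_dist_le_mul fun x hx y hy => ?_⟩
  simpa [dist_eq_norm] using hC x hx y hy

/-- A vector field which is bounded and Lipschitz on the unit ball admits a global solution of the
ODE obtained by precomposing with the radial retraction. -/
lemma exists_hasDerivAt_unitBallRetraction [NormedSpace ℝ E] [CompleteSpace E] {v : E → E}
    (hv : BoundedLipschitzOn v (Metric.closedBall 0 1)) (x₀ : E) :
    ∃ u : ℝ → E, u 0 = x₀ ∧ ∀ t, HasDerivAt u (v (unitBallRetraction (u t))) t := by
  obtain ⟨C, hC, hC'⟩ := hv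
  have hmem : ∀ x : E, unitBallRetraction x ∈ Metric.closedBall (0 : E) 1 := fun x =>
    mem_closedBall_zero_iff.2 (norm_unitBallRetraction_le x)
  refine exists_hasDerivAt_of_bounded_lipschitz (K := 2 * C) (L := C)
    (LipschitzWith.of_dist_le_mul fun x y => ?_) (fun x => hC _ (hmem x)) x₀
  rw [dist_eq_norm, dist_eq_norm]
  refine (hC' _ (hmem x) _ (hmem y)).trans ?_
  push_cast
  nlinarith [mul_le_mul_of_nonneg_left (norm_unitBallRetraction_sub_le x y) C.coe_nonneg]

end BoundedLipschitzOn

/-! ### The Brockett flow in a `C⋆`-algebra -/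

section BrockettFlow

variable {R : Type*} [NormedRing R]

/-- The Brockett vector field `H ↦ [H, [H, A]]`. -/
def brockettField (A H : R) : R := H * (H * A - A * H) - (H * A - A * H) * H

lemma boundedLipschitzOn_brockettField (A : R) (r : NNReal) :
    BoundedLipschitzOn (brockettField A) (Metric.closedBall 0 r) := by
  have hid := BoundedLipschitzOn.id_closedBall (E := R) r
  have hA := BoundedLipschitzOn.const A (Metric.closedBall (0 : R) r)
  have hG := (hid.mul hA).sub (hA.mul hid)
  exact (hid.mul hG).sub (hG.mul hid)

variable [NormedAlgebra ℝ R]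

lemma brockettField_unique {A : R} {H K : ℝ → R} (h0 : K 0 = H 0)
    (hH : ∀ t ∈ Ici (0 : ℝ), HasDerivWithinAt H (brockettField A (H t)) (Ici 0) t)
    (hK : ∀ t ∈ Ici (0 : ℝ), HasDerivWithinAt K (brockettField A (K t)) (Ici 0) t) :
    ∀ t ∈ Ici (0 : ℝ), K t = H t := by
  intro T hT
  have hcont : ∀ {X : ℝ → R},
      (∀ t ∈ Ici (0 : ℝ), HasDerivWithinAt X (brockettField A (X t)) (Ici 0) t) →
      ContinuousOn X (Icc 0 T) := fun hX t ht =>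
    (hX t ht.1).continuousWithinAt.mono Icc_subset_Ici_self
  obtain ⟨C, hC⟩ := isCompact_Icc.exists_bound_of_continuousOn (hcont hH)
  obtain ⟨D, hD⟩ := isCompact_Icc.exists_bound_of_continuousOn (hcont hK)
  set r : NNReal := ⟨max 0 (max C D), le_max_left _ _⟩ with hr
  have hrC : C ≤ r := (le_max_left C D).trans (le_max_right _ _)
  have hrD : D ≤ r := (le_max_right C D).trans (le_max_right _ _)
  obtain ⟨L, hL⟩ := (boundedLipschitzOn_brockettField A r).lipschitzOnWith
  have hIci : ∀ {X : ℝ → R},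
      (∀ t ∈ Ici (0 : ℝ), HasDerivWithinAt X (brockettField A (X t)) (Ici 0) t) →
      ∀ t ∈ Ico 0 T, HasDerivWithinAt X (brockettField A (X t)) (Ici t) t := fun hX t ht =>
    (hX t ht.1).mono (Ici_subset_Ici.2 ht.1)
  exact ODE_solution_unique_of_mem_Icc_right (v := fun _ => brockettField A)
    (s := fun _ => Metric.closedBall 0 r) (fun _ _ => hL) (hcont hK) (hIci hK)
    (fun t ht => mem_closedBall_zero_iff.2 ((hD t (Ico_subset_Icc_self ht)).trans hrD))
    (hcont hH) (hIci hH)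
    (fun t ht => mem_closedBall_zero_iff.2 ((hC t (Ico_subset_Icc_self ht)).trans hrC))
    h0 ⟨hT, le_rfl⟩

variable [StarRing R] [CStarRing R] [StarModule ℝ R] [CompleteSpace R]

/-- The Brockett flow is a conjugation `H t = (U t)⋆ H₀ (U t)` by contractions. -/
lemma exists_brockettField_conjugation {A H₀ : R} (hA : IsSelfAdjoint A)
    (hH₀ : IsSelfAdjoint H₀) :
    ∃ U : ℝ → R, U 0 = 1 ∧ (∀ t, ‖U t‖ ≤ 1) ∧
      ∀ t, HasDerivAt (fun s => star (U s) * H₀ * U s)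
        (brockettField A (star (U t) * H₀ * U t)) t := by
  set G : R → R := fun V => star V * H₀ * V * A - A * (star V * H₀ * V) with hGdef
  have hG : ∀ V, star (G V) = -G V := by
    intro V
    simp only [hGdef, star_sub, star_mul, star_star, hA.star_eq, hH₀.star_eq, mul_assoc]
    abel
  have hBL : BoundedLipschitzOn (fun V : R => V * G V) (Metric.closedBall 0 1) := by
    have hid := BoundedLipschitzOn.id_closedBall (E := R) 1
    have hA := BoundedLipschitzOn.const A (Metric.closedBall (0 : R) (1 : NNReal))
    have hH := (hid.star.mul (BoundedLipschitzOn.const H₀ _)).mul hid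
    exact hid.mul ((hH.mul hA).sub (hA.mul hH))
  obtain ⟨U, hU0, hU⟩ := hBL.exists_hasDerivAt_unitBallRetraction (1 : R)
  have hUU : ∀ t, U t * star (U t) = 1 := by
    have hd : ∀ t, HasDerivAt (fun s => U s * star (U s)) 0 t := by
      intro t
      refine ((hU t).mul (hU t).star).congr_deriv ?_
      set c := (max 1 ‖U t‖)⁻¹
      have hret : unitBallRetraction (U t) = c • U t := rfl
      rw [star_mul, hG, hret, star_smul]
      simp only [smul_mul_assoc, mul_smul_comm, star_trivial, mul_neg, neg_mul, mul_assoc]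
      simp
    have hconst := is_const_of_deriv_eq_zero (fun t => (hd t).differentiableAt)
      (fun t => (hd t).deriv)
    intro t
    simpa [hU0] using hconst t 0
  have hnorm : ∀ t, ‖U t‖ ≤ 1 := by
    intro t
    rcases subsingleton_or_nontrivial R with h | h
    · simp [Subsingleton.elim (U t) 0]
    · have := CStarRing.norm_self_mul_star (x := U t)
      rw [hUU, CStarRing.norm_one] at this
      nlinarith [norm_nonneg (U t)]
  refine ⟨U, hU0, hnorm, fun t => ?_⟩
  have hUt := hU t
  rw [unitBallRetraction_of_norm_le (hnorm t)] at hUt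
  refine ((hUt.star.mul_const H₀).mul hUt).congr_deriv ?_
  rw [star_mul, hG]
  simp only [hGdef, brockettField]
  noncomm_ring

end BrockettFlow

/-! ### Functions dominated by the derivative of a bounded function -/

/-- `f` is pointwise at most the derivative of a bounded function. For nonnegative `f` this is a
form of integrability on the real line. -/
def IsDissipated (f : ℝ → ℝ) : Prop :=
  ∃ (Φ Φ' : ℝ → ℝ) (B : ℝ), ∀ t, HasDerivAt Φ (Φ' t) t ∧ f t ≤ Φ' t ∧ |Φ t| ≤ B

namespace IsDissipated

variable {f g : ℝ → ℝ}

lemma mono (hf : IsDissipated f) (hgf : ∀ t, g t ≤ f t) : IsDissipated g := by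
  obtain ⟨Φ, Φ', B, h⟩ := hf
  exact ⟨Φ, Φ', B, fun t => ⟨(h t).1, (hgf t).trans (h t).2.1, (h t).2.2⟩⟩

lemma of_hasDerivAt {Φ Φ' : ℝ → ℝ} {B : ℝ} (hΦ : ∀ t, HasDerivAt Φ (Φ' t) t)
    (hB : ∀ t, |Φ t| ≤ B) : IsDissipated Φ' :=
  ⟨Φ, Φ', B, fun t => ⟨hΦ t, le_rfl, hB t⟩⟩

lemma zero : IsDissipated fun _ => 0 :=
  of_hasDerivAt (Φ := fun _ => 0) (B := 0) (fun _ => hasDerivAt_const _ _) (by simp)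

lemma add (hf : IsDissipated f) (hg : IsDissipated g) : IsDissipated fun t => f t + g t := by
  obtain ⟨Φ, Φ', B, h⟩ := hf
  obtain ⟨Ψ, Ψ', D, k⟩ := hg
  exact ⟨fun t => Φ t + Ψ t, fun t => Φ' t + Ψ' t, B + D, fun t =>
    ⟨(h t).1.add (k t).1, add_le_add (h t).2.1 (k t).2.1,
      (abs_add_le _ _).trans (add_le_add (h t).2.2 (k t).2.2)⟩⟩

lemma const_mul (hf : IsDissipated f) {c : ℝ} (hc : 0 ≤ c) : IsDissipated fun t => c * f t := by
  obtain ⟨Φ, Φ', B, h⟩ := hf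
  refine ⟨fun t => c * Φ t, fun t => c * Φ' t, c * B, fun t =>
    ⟨(h t).1.const_mul c, mul_le_mul_of_nonneg_left (h t).2.1 hc, ?_⟩⟩
  rw [abs_mul, abs_of_nonneg hc]
  exact mul_le_mul_of_nonneg_left (h t).2.2 hc

lemma sum {ι : Type*} {s : Finset ι} {f : ι → ℝ → ℝ} (hf : ∀ i ∈ s, IsDissipated (f i)) :
    IsDissipated fun t => ∑ i ∈ s, f i t := by
  classical
  induction s using Finset.induction_on with
  | empty => simpa using zero
  | insert i s hi ih =>
    simp only [Finset.sum_insert hi]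
    exact (hf i (Finset.mem_insert_self i s)).add
      (ih fun j hj => hf j (Finset.mem_insert_of_mem hj))

/-- A bounded function with nonnegative derivative converges at infinity. -/
lemma _root_.exists_tendsto_atTop_of_hasDerivAt_nonneg {Φ Φ' : ℝ → ℝ} {B : ℝ}
    (hΦ : ∀ t, HasDerivAt Φ (Φ' t) t) (hΦ' : ∀ t, 0 ≤ Φ' t) (hB : ∀ t, |Φ t| ≤ B) :
    ∃ l, Tendsto Φ atTop (nhds l) :=
  ⟨_, tendsto_atTop_ciSup (monotone_of_hasDerivAt_nonneg hΦ hΦ')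
    ⟨B, by rintro _ ⟨t, rfl⟩; exact (le_abs_self _).trans (hB t)⟩⟩

lemma exists_tendsto_atTop (hf : IsDissipated f) (hf0 : ∀ t, 0 ≤ f t) {h h' : ℝ → ℝ} {B : ℝ}
    (hh : ∀ t, HasDerivAt h (h' t) t) (hB : ∀ t, |h t| ≤ B) (hh' : ∀ t, |h' t| ≤ f t) :
    ∃ l, Tendsto h atTop (nhds l) := by
  obtain ⟨Φ, Φ', D, k⟩ := hf
  obtain ⟨l, hl⟩ := exists_tendsto_atTop_of_hasDerivAt_nonneg (fun t => (k t).1)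
    (fun t => (hf0 t).trans (k t).2.1) (fun t => (k t).2.2)
  obtain ⟨m, hm⟩ := exists_tendsto_atTop_of_hasDerivAt_nonneg (fun t => (hh t).add (k t).1)
    (fun t => by linarith [neg_abs_le (h' t), hh' t, (k t).2.1])
    (fun t => (abs_add_le _ _).trans (add_le_add (hB t) (k t).2.2))
  exact ⟨m - l, by simpa using hm.sub hl⟩

/-- Barbalat's lemma. -/
lemma tendsto_zero (hf : IsDissipated f) (hf0 : ∀ t, 0 ≤ f t) {L : NNReal}
    (hL : LipschitzWith L f) : Tendsto f atTop (nhds 0) := by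
  obtain ⟨Φ, Φ', D, k⟩ := hf
  obtain ⟨l, hl⟩ := exists_tendsto_atTop_of_hasDerivAt_nonneg (fun t => (k t).1)
    (fun t => (hf0 t).trans (k t).2.1) (fun t => (k t).2.2)
  rw [Metric.tendsto_atTop]
  intro ε hε
  set δ : ℝ := ε / (2 * (L + 1)) with hδdef
  have hL1 : (0 : ℝ) < L + 1 := by positivity
  have hδ : 0 < δ := by positivity
  have hLδ : L * δ ≤ ε / 2 := by
    have : (L + 1) * δ = ε / 2 := by rw [hδdef]; field_simp
    nlinarith
  have hinc : Tendsto (fun t => Φ (t + δ) - Φ t) atTop (nhds 0) := by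
    simpa using (hl.comp (tendsto_atTop_add_const_right _ δ tendsto_id)).sub hl
  obtain ⟨N, hN⟩ := Filter.eventually_atTop.1
    (hinc.eventually (gt_mem_nhds (by positivity : 0 < ε / 2 * δ)))
  refine ⟨N, fun t ht => ?_⟩
  rw [Real.dist_0_eq_abs, abs_of_nonneg (hf0 t)]
  by_contra! hge
  have hmvt := (convex_Icc t (t + δ)).mul_sub_le_image_sub_of_le_deriv (f := Φ) (C := ε / 2)
    (fun s _ => (k s).1.continuousAt.continuousWithinAt)
    (fun s _ => (k s).1.differentiableAt.differentiableWithinAt)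
    (fun s hs => by
      rw [interior_Icc] at hs
      rw [(k s).1.deriv]
      refine le_trans ?_ (k s).2.1
      have hdist := hL.dist_le_mul s t
      rw [Real.dist_eq, Real.dist_eq, abs_of_pos (sub_pos.2 hs.1)] at hdist
      have : (L : ℝ) * (s - t) ≤ L * δ :=
        mul_le_mul_of_nonneg_left (by linarith [hs.2]) L.coe_nonneg
      linarith [neg_abs_le (f s - f t)])
    t ⟨le_rfl, by linarith⟩ (t + δ) ⟨by linarith, le_rfl⟩ (by linarith)
  have := hN t ht
  rw [add_sub_cancel_left] at hmvt
  linarith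

end IsDissipated

/-! ### Hilbert–Schmidt operators in a Hilbert basis -/

section HilbertSchmidt

open scoped ENNReal

variable {𝓗 : Type*} [NormedAddCommGroup 𝓗] [InnerProductSpace ℝ 𝓗] {ι : Type*}

/-- The square of the Hilbert–Schmidt norm of `T` computed in the Hilbert basis `e`. -/
noncomputable def hilbertSchmidtSq (e : HilbertBasis ι ℝ 𝓗) (T : 𝓗 →L[ℝ] 𝓗) : ℝ≥0∞ :=
  ∑' n, ENNReal.ofReal (‖T (e n)‖ ^ 2)

variable (e : HilbertBasis ι ℝ 𝓗)

lemma HilbertBasis.hasSum_sq_inner (x : 𝓗) : HasSum (fun k => ⟪e k, x⟫ ^ 2) (‖x‖ ^ 2) := by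
  have h := e.hasSum_inner_mul_inner x x
  rw [real_inner_self_eq_norm_sq] at h
  simpa only [real_inner_comm x, ← sq] using h

lemma summable_iff_hilbertSchmidtSq_ne_top (T : 𝓗 →L[ℝ] 𝓗) :
    (Summable fun n => ‖T (e n)‖ ^ 2) ↔ hilbertSchmidtSq e T ≠ ∞ := by
  refine ⟨fun h => h.tsum_ofReal_ne_top, fun h => ?_⟩
  simpa [ENNReal.toReal_ofReal, sq_nonneg] using ENNReal.summable_toReal h

lemma hilbertSchmidtSq_mul_le {S T : 𝓗 →L[ℝ] 𝓗} (hS : ‖S‖ ≤ 1) :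
    hilbertSchmidtSq e (S * T) ≤ hilbertSchmidtSq e T := by
  refine ENNReal.tsum_le_tsum fun n => ENNReal.ofReal_le_ofReal ?_
  gcongr
  exact S.le_of_opNorm_le_of_le hS le_rfl |>.trans_eq (one_mul _)

variable [CompleteSpace 𝓗]

lemma hilbertSchmidtSq_star (T : 𝓗 →L[ℝ] 𝓗) :
    hilbertSchmidtSq e (star T) = hilbertSchmidtSq e T := by
  have h : ∀ S : 𝓗 →L[ℝ] 𝓗, hilbertSchmidtSq e S
      = ∑' n, ∑' k, ENNReal.ofReal (⟪e k, S (e n)⟫ ^ 2) := fun S => tsum_congr fun n => by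
    rw [← (e.hasSum_sq_inner (S (e n))).tsum_eq,
      ENNReal.ofReal_tsum_of_nonneg (fun _ => sq_nonneg _) (e.hasSum_sq_inner _).summable]
  rw [h, h, ENNReal.tsum_comm]
  simp only [ContinuousLinearMap.star_eq_adjoint, ContinuousLinearMap.adjoint_inner_right,
    real_inner_comm]

lemma hilbertSchmidtSq_star_mul_mul_le {U T : 𝓗 →L[ℝ] 𝓗} (hU : ‖U‖ ≤ 1) :
    hilbertSchmidtSq e (star U * T * U) ≤ hilbertSchmidtSq e T := by
  have hU' : ‖star U‖ ≤ 1 := by simpa [star_eq_adjoint] using hU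
  calc hilbertSchmidtSq e (star U * T * U) ≤ hilbertSchmidtSq e (T * U) := by
        rw [mul_assoc]; exact hilbertSchmidtSq_mul_le e hU'
    _ = hilbertSchmidtSq e (star U * star T) := by rw [← hilbertSchmidtSq_star, star_mul]
    _ ≤ hilbertSchmidtSq e T := by
        rw [← hilbertSchmidtSq_star e T]; exact hilbertSchmidtSq_mul_le e hU'

/-- Operators with diagonal matrices are self-adjoint. -/
lemma isSelfAdjoint_of_diagonal {A : 𝓗 →L[ℝ] 𝓗} {a : ι → ℝ} (hA : ∀ i, A (e i) = a i • e i) :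
    IsSelfAdjoint A := by
  classical
  refine ContinuousLinearMap.ext_on
    (Submodule.dense_iff_topologicalClosure_eq_top.2 e.dense_span) ?_
  rintro _ ⟨i, rfl⟩
  refine ext_inner_left ℝ fun x => ?_
  rw [← (e.hasSum_inner_mul_inner x _).tsum_eq, ← (e.hasSum_inner_mul_inner x _).tsum_eq]
  refine tsum_congr fun j => ?_
  rw [star_eq_adjoint, adjoint_inner_right, hA, hA, inner_smul_left, inner_smul_right,
    orthonormal_iff_ite.1 e.orthonormal]
  split_ifs with h <;> simp [h]

/-- Uniformly bounded self-maps converging on a Hilbert basis converge strongly. -/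
lemma exists_tendsto_of_tendsto_basis {T : ℝ → 𝓗 →L[ℝ] 𝓗} {r : ℝ} (hr : ∀ t, ‖T t‖ ≤ r)
    (hT : ∀ i, ∃ y, Tendsto (fun t => T t (e i)) atTop (nhds y)) :
    ∃ S : 𝓗 →L[ℝ] 𝓗, ∀ x, Tendsto (fun t => T t x) atTop (nhds (S x)) := by
  have hspan : ∀ x ∈ Submodule.span ℝ (range e),
      ∃ y, Tendsto (fun t => T t x) atTop (nhds y) := by
    intro x hx
    induction hx using Submodule.span_induction with
    | mem x hx => obtain ⟨i, rfl⟩ := hx; exact hT i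
    | zero => exact ⟨0, by simp⟩
    | add x y _ _ hx hy =>
      obtain ⟨u, hu⟩ := hx
      obtain ⟨v, hv⟩ := hy
      exact ⟨u + v, by simpa using hu.add hv⟩
    | smul c x _ hx =>
      obtain ⟨u, hu⟩ := hx
      exact ⟨c • u, by simpa using hu.const_smul c⟩
  have hr0 : 0 ≤ r := (norm_nonneg _).trans (hr 0)
  have hall : ∀ x, ∃ y, Tendsto (fun t => T t x) atTop (nhds y) := by
    intro x
    refine cauchy_map_iff_exists_tendsto.1 ?_
    refine Metric.cauchy_iff.2 ⟨inferInstance, fun ε hε => ?_⟩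
    obtain ⟨y, hy, hxy⟩ := Metric.mem_closure_iff.1
      ((Submodule.dense_iff_topologicalClosure_eq_top.2 e.dense_span) x)
      (ε / (4 * (r + 1))) (by positivity)
    obtain ⟨z, hz⟩ := hspan y hy
    have hclose : ∀ᶠ t in atTop, ‖T t x - z‖ < ε / 2 := by
      filter_upwards [(Metric.tendsto_nhds.1 hz) (ε / 4) (by positivity)] with t ht
      rw [dist_eq_norm] at ht hxy
      have hb : ‖T t (x - y)‖ ≤ ε / 4 := by
        refine ((T t).le_of_opNorm_le_of_le (hr t) hxy.le).trans ?_
        rw [mul_div_assoc', div_le_div_iff₀ (by positivity) (by norm_num)]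
        nlinarith
      calc ‖T t x - z‖ = ‖T t (x - y) + (T t y - z)‖ := by rw [map_sub]; abel_nf
        _ ≤ ‖T t (x - y)‖ + ‖T t y - z‖ := norm_add_le _ _
        _ < ε / 2 := by linarith
    refine ⟨_, image_mem_map hclose, ?_⟩
    rintro _ ⟨s, hs, rfl⟩ _ ⟨t, ht, rfl⟩
    change ‖T s x - z‖ < ε / 2 at hs
    change ‖T t x - z‖ < ε / 2 at ht
    calc dist (T s x) (T t x) ≤ dist (T s x) z + dist (T t x) z := dist_triangle_right _ _ _
      _ < ε := by rw [dist_eq_norm, dist_eq_norm]; linarith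
  choose f hf using hall
  exact ⟨continuousLinearMapOfTendsto T (tendsto_pi_nhds.2 hf), hf⟩

end HilbertSchmidt

/-- A family of square-summable sequences which is bounded in `ℓ²` and converges to zero
coordinatewise converges weakly to zero. -/
lemma tendsto_tsum_inner_zero {𝓗 α : Type*} [NormedAddCommGroup 𝓗] [InnerProductSpace ℝ 𝓗]
    {l : Filter α} {b : ℕ → 𝓗} {d : α → ℕ → 𝓗} {M : ℝ} (hb : Summable fun n => ‖b n‖ ^ 2)
    (hd : ∀ t, Summable fun n => ‖d t n‖ ^ 2) (hM : ∀ t, ∑' n, ‖d t n‖ ^ 2 ≤ M)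
    (hlim : ∀ n, Tendsto (fun t => d t n) l (nhds 0)) :
    Tendsto (fun t => ∑' n, ⟪b n, d t n⟫) l (nhds 0) := by
  rw [Metric.tendsto_nhds]
  intro ε hε
  set K : ℝ := |M| + 1 with hK
  have hKpos : 0 < K := by positivity
  set c : ℝ := ε / (4 * K) with hc
  have hcpos : 0 < c := by positivity
  have hyoung : ∀ x y : 𝓗, |⟪x, y⟫| ≤ c⁻¹ * ‖x‖ ^ 2 + c * ‖y‖ ^ 2 := by
    intro x y
    refine (abs_real_inner_le_norm x y).trans ?_
    have h1 : c * (c⁻¹ * ‖x‖ ^ 2 + c * ‖y‖ ^ 2) = ‖x‖ ^ 2 + (c * ‖y‖) ^ 2 := by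
      field_simp
    refine le_of_mul_le_mul_left ?_ hcpos
    rw [h1]
    nlinarith [sq_nonneg (‖x‖ - c * ‖y‖), norm_nonneg x, mul_nonneg hcpos.le (norm_nonneg y)]
  have hsum : ∀ t, Summable fun n => |⟪b n, d t n⟫| := fun t =>
    Summable.of_nonneg_of_le (fun _ => abs_nonneg _) (fun n => hyoung _ _)
      ((hb.mul_left _).add ((hd t).mul_left _))
  obtain ⟨N, hN⟩ := ((tendsto_sum_nat_add fun n => ‖b n‖ ^ 2).eventually
    (gt_mem_nhds (by positivity : 0 < c * (ε / 4)))).exists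
  have hfin : Tendsto (fun t => ∑ n ∈ Finset.range N, |⟪b n, d t n⟫|) l (nhds 0) := by
    simpa using tendsto_finsetSum (Finset.range N) fun n _ =>
      ((tendsto_const_nhds (x := b n)).inner (𝕜 := ℝ) (hlim n)).abs
  filter_upwards [hfin.eventually (gt_mem_nhds (half_pos hε))] with t ht
  rw [dist_zero_right]
  have htail : ∑' n, |⟪b (n + N), d t (n + N)⟫| < ε / 2 := by
    have hb' := (summable_nat_add_iff N).2 hb
    have hd' := (summable_nat_add_iff N).2 (hd t)
    calc ∑' n, |⟪b (n + N), d t (n + N)⟫|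
        ≤ ∑' n, (c⁻¹ * ‖b (n + N)‖ ^ 2 + c * ‖d t (n + N)‖ ^ 2) :=
          ((summable_nat_add_iff N).2 (hsum t)).tsum_le_tsum (fun n => hyoung _ _)
            ((hb'.mul_left _).add (hd'.mul_left _))
      _ = c⁻¹ * ∑' n, ‖b (n + N)‖ ^ 2 + c * ∑' n, ‖d t (n + N)‖ ^ 2 := by
          rw [(hb'.mul_left _).tsum_add (hd'.mul_left _), tsum_mul_left, tsum_mul_left]
      _ < ε / 4 + ε / 4 := by
          refine add_lt_add_of_lt_of_le ?_ ?_
          · rw [inv_mul_lt_iff₀ hcpos]; exact hN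
          · have h1 : ∑' n, ‖d t (n + N)‖ ^ 2 ≤ K := by
              have h2 := (hd t).sum_add_tsum_nat_add N
              have h3 : 0 ≤ ∑ n ∈ Finset.range N, ‖d t n‖ ^ 2 :=
                Finset.sum_nonneg fun _ _ => sq_nonneg _
              linarith [hM t, le_abs_self M]
            calc c * ∑' n, ‖d t (n + N)‖ ^ 2 ≤ c * K := by gcongr
              _ = ε / 4 := by rw [hc]; field_simp
      _ = ε / 2 := by ring
  calc ‖∑' n, ⟪b n, d t n⟫‖ ≤ ∑' n, |⟪b n, d t n⟫| := norm_tsum_le_tsum_norm (hsum t)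
    _ = ∑ n ∈ Finset.range N, |⟪b n, d t n⟫| + ∑' n, |⟪b (n + N), d t (n + N)⟫| :=
        ((hsum t).sum_add_tsum_nat_add N).symm
    _ < ε := by linarith

/-! ### Asymptotics of the Brockett flow -/

section Asymptotics

variable {𝓗 : Type*} [NormedAddCommGroup 𝓗] [InnerProductSpace ℝ 𝓗]
  (e : HilbertBasis ℕ ℝ 𝓗)

/-- The `n`-th column of `T` with its diagonal entry removed. -/
noncomputable def offDiagCol (T : 𝓗 →L[ℝ] 𝓗) (n : ℕ) : 𝓗 := T (e n) - ⟪e n, T (e n)⟫ • e n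

lemma inner_offDiagCol_self (T : 𝓗 →L[ℝ] 𝓗) (n : ℕ) : ⟪e n, offDiagCol e T n⟫ = 0 := by
  simp [offDiagCol, inner_sub_right, inner_smul_right, e.orthonormal.1 n]

lemma inner_offDiagCol_of_ne (T : 𝓗 →L[ℝ] 𝓗) {k n : ℕ} (h : k ≠ n) :
    ⟪e k, offDiagCol e T n⟫ = ⟪e k, T (e n)⟫ := by
  simp [offDiagCol, inner_sub_right, inner_smul_right, e.orthonormal.2 h]

lemma norm_apply_basis_le (T : 𝓗 →L[ℝ] 𝓗) (n : ℕ) : ‖T (e n)‖ ≤ ‖T‖ :=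
  T.unit_le_opNorm _ (e.orthonormal.1 n).le

lemma abs_inner_apply_basis_le (T : 𝓗 →L[ℝ] 𝓗) (n : ℕ) : |⟪e n, T (e n)⟫| ≤ ‖T‖ := by
  refine (abs_real_inner_le_norm _ _).trans ?_
  rw [e.orthonormal.1 n, one_mul]
  exact norm_apply_basis_le e T n

lemma norm_offDiagCol_le (T : 𝓗 →L[ℝ] 𝓗) (n : ℕ) : ‖offDiagCol e T n‖ ≤ 2 * ‖T‖ := by
  rw [two_mul]
  refine norm_sub_le_of_le (norm_apply_basis_le e T n) ?_
  rw [norm_smul, e.orthonormal.1 n, mul_one]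
  exact abs_inner_apply_basis_le e T n

lemma hasDerivAt_apply {H : ℝ → 𝓗 →L[ℝ] 𝓗} {H' : 𝓗 →L[ℝ] 𝓗} {t : ℝ}
    (h : HasDerivAt H H' t) (x : 𝓗) : HasDerivAt (fun s => H s x) (H' x) t :=
  (ContinuousLinearMap.apply ℝ 𝓗 x).hasFDerivAt.comp_hasDerivAt t h

lemma hasDerivAt_inner_apply {H : ℝ → 𝓗 →L[ℝ] 𝓗} {H' : 𝓗 →L[ℝ] 𝓗} {t : ℝ}
    (h : HasDerivAt H H' t) (x y : 𝓗) : HasDerivAt (fun s => ⟪x, H s y⟫) ⟪x, H' y⟫ t :=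
  (innerSL ℝ x).hasFDerivAt.comp_hasDerivAt t (hasDerivAt_apply h y)

lemma hasDerivAt_offDiagCol {H : ℝ → 𝓗 →L[ℝ] 𝓗} {H' : 𝓗 →L[ℝ] 𝓗} {t : ℝ}
    (h : HasDerivAt H H' t) (n : ℕ) : HasDerivAt (fun s => offDiagCol e (H s) n) (offDiagCol e H' n) t :=
  (hasDerivAt_apply h _).sub ((hasDerivAt_inner_apply h _ _).smul_const _)

variable [CompleteSpace 𝓗]

lemma sq_inner_offDiagCol_le {T : 𝓗 →L[ℝ] 𝓗} (hT : IsSelfAdjoint T) {k n : ℕ} (h : k ≠ n) :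
    ⟪e k, offDiagCol e T n⟫ ^ 2 ≤ ‖offDiagCol e T k‖ ^ 2 := by
  have hsym : ⟪e k, offDiagCol e T n⟫ = ⟪e n, offDiagCol e T k⟫ := by
    rw [inner_offDiagCol_of_ne e T h, inner_offDiagCol_of_ne e T h.symm, real_inner_comm]
    exact hT.isSymmetric _ _
  rw [hsym, sq_le_sq, abs_norm]
  refine (abs_real_inner_le_norm _ _).trans ?_
  rw [e.orthonormal.1 n, one_mul]

variable {A : 𝓗 →L[ℝ] 𝓗} {a : ℕ → ℝ} (hA : ∀ ℓ, A (e ℓ) = a ℓ • e ℓ)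

include hA

lemma inner_brockettField {T : 𝓗 →L[ℝ] 𝓗} (hT : IsSelfAdjoint T) (n : ℕ) :
    ⟪e n, brockettField A T (e n)⟫
      = 2 * ⟪offDiagCol e T n, a n • offDiagCol e T n - A (offDiagCol e T n)⟫ := by
  set v := offDiagCol e T n with hv
  have hTsym : ∀ x y, ⟪T x, y⟫ = ⟪x, T y⟫ := hT.isSymmetric
  have hAsym : ∀ x y, ⟪A x, y⟫ = ⟪x, A y⟫ := (isSelfAdjoint_of_diagonal e hA).isSymmetric
  have hTe : T (e n) = v + ⟪e n, T (e n)⟫ • e n := by simp [hv, offDiagCol]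
  set G := T * A - A * T with hG
  have hGe : G (e n) = a n • v - A v := by
    simp only [hG, sub_apply, mul_apply_eq_comp, hA, map_smul]
    rw [hTe, map_add, map_smul, hA]
    module
  have hskew : ⟪e n, G (T (e n))⟫ = -⟪T (e n), G (e n)⟫ := by
    have h : ⟪e n, A (T (T (e n)))⟫ = ⟪T (e n), T (A (e n))⟫ := by
      rw [← hAsym, ← hTsym, real_inner_comm]
    simp only [hG, sub_apply, mul_apply_eq_comp, inner_sub_right]
    rw [h, ← hTsym, neg_sub]
  have horth : ⟪e n, a n • v - A v⟫ = 0 := by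
    rw [inner_sub_right, ← hAsym, hA, inner_smul_right, real_inner_smul_left, sub_self]
  have hexp : ⟪e n, brockettField A T (e n)⟫ = ⟪e n, T (G (e n))⟫ - ⟪e n, G (T (e n))⟫ := by
    simp only [brockettField, ← hG, sub_apply, mul_apply_eq_comp, inner_sub_right]
  rw [hexp, hskew, ← hTsym, hGe, hTe, inner_add_left, real_inner_smul_left, horth]
  ring

lemma abs_inner_brockettField_le {T : 𝓗 →L[ℝ] 𝓗} (hT : IsSelfAdjoint T) (n : ℕ) :
    |⟪e n, brockettField A T (e n)⟫| ≤ 2 * (|a n| + ‖A‖) * ‖offDiagCol e T n‖ ^ 2 := by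
  set v := offDiagCol e T n with hv
  rw [inner_brockettField e hA hT, abs_mul, abs_two, mul_assoc]
  refine mul_le_mul_of_nonneg_left ((abs_real_inner_le_norm _ _).trans ?_) zero_le_two
  have h : ‖a n • v - A v‖ ≤ |a n| * ‖v‖ + ‖A‖ * ‖v‖ :=
    norm_sub_le_of_le (norm_smul _ _).le (A.le_opNorm v)
  calc ‖v‖ * ‖a n • v - A v‖ ≤ ‖v‖ * (|a n| * ‖v‖ + ‖A‖ * ‖v‖) := by gcongr
    _ = (|a n| + ‖A‖) * ‖v‖ ^ 2 := by ring

/-- Coercivity of `a n - A` off the `n`-th coordinate, up to the coordinates below `n`. -/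
lemma le_inner_smul_sub_of_gap (ha : Antitone a) {n : ℕ} {c : ℝ}
    (hgap : ∀ j, j ≠ n → c ≤ |a j - a n|) {v : 𝓗} (hv : ⟪e n, v⟫ = 0) :
    c * ‖v‖ ^ 2 - (a 0 - a n + c) * ∑ k ∈ Finset.range n, ⟪e k, v⟫ ^ 2
      ≤ ⟪v, a n • v - A v⟫ := by
  have hAsym : ∀ x y, ⟪A x, y⟫ = ⟪x, A y⟫ := (isSelfAdjoint_of_diagonal e hA).isSymmetric
  have h1 : HasSum (fun k => (a n - a k) * ⟪e k, v⟫ ^ 2) ⟪v, a n • v - A v⟫ := by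
    have h (k : ℕ) : (a n - a k) * ⟪e k, v⟫ ^ 2 = ⟪v, e k⟫ * ⟪e k, a n • v - A v⟫ := by
      rw [inner_sub_right, ← hAsym, hA, inner_smul_right, real_inner_smul_left,
        real_inner_comm v (e k)]
      ring
    simpa only [h] using e.hasSum_inner_mul_inner v (a n • v - A v)
  have h2 : HasSum (fun k => if k ∈ Finset.range n then ⟪e k, v⟫ ^ 2 else 0)
      (∑ k ∈ Finset.range n, ⟪e k, v⟫ ^ 2) := by
    rw [Finset.sum_congr rfl fun k hk => (if_pos hk).symm]
    exact hasSum_sum_of_ne_finset_zero fun k hk => if_neg hk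
  refine hasSum_le (fun k => ?_)
    (((e.hasSum_sq_inner v).mul_left c).sub (h2.mul_left (a 0 - a n + c))) h1
  rcases lt_trichotomy k n with hk | rfl | hk
  · rw [if_pos (Finset.mem_range.2 hk)]
    have := ha (Nat.zero_le k)
    nlinarith [sq_nonneg ⟪e k, v⟫]
  · simp [hv]
  · rw [if_neg (by simpa using hk.le)]
    have h := hgap k hk.ne'
    rw [abs_of_nonpos (sub_nonpos.2 (ha hk.le))] at h
    nlinarith [sq_nonneg ⟪e k, v⟫]

variable {H : ℝ → 𝓗 →L[ℝ] 𝓗} {r : ℝ}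

lemma isDissipated_sq_norm_offDiagCol (ha : Antitone a)
    (hgap : ∀ ℓ : ℕ, ∃ c : ℝ, 0 < c ∧ ∀ j : ℕ, j ≠ ℓ → c ≤ |a j - a ℓ|)
    (hsa : ∀ t, IsSelfAdjoint (H t)) (hr : ∀ t, ‖H t‖ ≤ r)
    (hH : ∀ t, HasDerivAt H (brockettField A (H t)) t) (n : ℕ) :
    IsDissipated fun t => ‖offDiagCol e (H t) n‖ ^ 2 := by
  induction n using Nat.strong_induction_on with
  | _ n ih =>
    obtain ⟨c, hc, hcgap⟩ := hgap n
    have hM : 0 ≤ a 0 - a n + c := by linarith [ha (Nat.zero_le n)]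
    have hdiag := IsDissipated.of_hasDerivAt
      (fun t => hasDerivAt_inner_apply (hH t) (e n) (e n))
      (fun t => (abs_inner_apply_basis_le e (H t) n).trans (hr t))
    have hsum : IsDissipated fun t => ∑ k ∈ Finset.range n, ‖offDiagCol e (H t) k‖ ^ 2 :=
      IsDissipated.sum fun k hk => ih k (Finset.mem_range.1 hk)
    refine (((hdiag.const_mul (by norm_num : (0 : ℝ) ≤ 1 / 2)).add
      (hsum.const_mul hM)).const_mul (inv_nonneg.2 hc.le)).mono fun t => ?_
    rw [← div_eq_inv_mul, le_div_iff₀ hc, inner_brockettField e hA (hsa t)]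
    have hcoer := le_inner_smul_sub_of_gap e hA ha hcgap (inner_offDiagCol_self e (H t) n)
    have hle : ∑ k ∈ Finset.range n, ⟪e k, offDiagCol e (H t) n⟫ ^ 2
        ≤ ∑ k ∈ Finset.range n, ‖offDiagCol e (H t) k‖ ^ 2 :=
      Finset.sum_le_sum fun k hk =>
        sq_inner_offDiagCol_le e (hsa t) (Finset.mem_range.1 hk).ne
    nlinarith [mul_le_mul_of_nonneg_left hle hM]

lemma exists_tendsto_brockett_basis (ha : Antitone a)
    (hgap : ∀ ℓ : ℕ, ∃ c : ℝ, 0 < c ∧ ∀ j : ℕ, j ≠ ℓ → c ≤ |a j - a ℓ|)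
    (hsa : ∀ t, IsSelfAdjoint (H t)) (hr : ∀ t, ‖H t‖ ≤ r)
    (hH : ∀ t, HasDerivAt H (brockettField A (H t)) t) (n : ℕ) :
    ∃ α : ℝ, Tendsto (fun t => H t (e n)) atTop (nhds (α • e n)) := by
  have hdis := isDissipated_sq_norm_offDiagCol e hA ha hgap hsa hr hH n
  obtain ⟨α, hα⟩ := (hdis.const_mul
      (by positivity : (0 : ℝ) ≤ 2 * (|a n| + ‖A‖))).exists_tendsto_atTop
    (fun t => by positivity) (fun t => hasDerivAt_inner_apply (hH t) (e n) (e n))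
    (fun t => (abs_inner_apply_basis_le e (H t) n).trans (hr t))
    (fun t => abs_inner_brockettField_le e hA (hsa t) n)
  have hr0 : 0 ≤ r := (norm_nonneg _).trans (hr 0)
  obtain ⟨C, hC, -⟩ := boundedLipschitzOn_brockettField A ⟨r, hr0⟩
  have hC' : ∀ t, ‖brockettField A (H t)‖ ≤ C := fun t =>
    hC _ (mem_closedBall_zero_iff.2 (hr t))
  have hd : ∀ t, HasDerivAt (fun s => ‖offDiagCol e (H s) n‖ ^ 2)
      (2 * ⟪offDiagCol e (H t) n, offDiagCol e (brockettField A (H t)) n⟫) t := fun t =>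
    (hasDerivAt_offDiagCol e (hH t) n).norm_sq
  have hlip : LipschitzWith (2 * (2 * ⟨r, hr0⟩ * (2 * C)))
      (fun t => ‖offDiagCol e (H t) n‖ ^ 2) := by
    refine lipschitzWith_of_nnnorm_deriv_le (fun t => (hd t).differentiableAt) fun t => ?_
    rw [(hd t).deriv, ← NNReal.coe_le_coe, coe_nnnorm, norm_mul, Real.norm_ofNat]
    push_cast
    refine mul_le_mul_of_nonneg_left ((norm_inner_le_norm _ _).trans ?_) zero_le_two
    exact mul_le_mul
      ((norm_offDiagCol_le e _ n).trans (mul_le_mul_of_nonneg_left (hr t) zero_le_two))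
      ((norm_offDiagCol_le e _ n).trans (mul_le_mul_of_nonneg_left (hC' t) zero_le_two))
      (norm_nonneg _) (by positivity)
  have hzero := hdis.tendsto_zero (fun t => by positivity) hlip
  have hoff : Tendsto (fun t => offDiagCol e (H t) n) atTop (nhds 0) := by
    rw [tendsto_zero_iff_norm_tendsto_zero]
    simpa [Real.sqrt_sq] using hzero.sqrt
  refine ⟨α, ?_⟩
  simpa [offDiagCol] using hoff.add (hα.smul_const (e n))

end Asymptotics

/-- Brockett flow in infinite dimension. Let `A = diag(a_ℓ)` be a bounded
diagonal operator with `(a_ℓ)` a non-increasing sequence of nonnegative reals such that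
`inf_{j≠ℓ} |a_j − a_ℓ| > 0` for every `ℓ`. Then for every symmetric Hilbert–Schmidt `H₀` the
Cauchy problem `H' = [H, [H, A]]`, `H(0) = H₀` admits a unique global solution
`H ∈ C¹([0,∞), S₂(𝓗))` which converges weakly in `S₂(𝓗)` (and strongly as an operator) to a
diagonal Hilbert–Schmidt operator. -/
theorem stmt17
    {𝓗 : Type*} [NormedAddCommGroup 𝓗] [InnerProductSpace ℝ 𝓗] [CompleteSpace 𝓗]
    (e : HilbertBasis ℕ ℝ 𝓗)
    (A : 𝓗 →L[ℝ] 𝓗) (a : ℕ → ℝ)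
    (hAdiag : ∀ ℓ, A (e ℓ) = a ℓ • e ℓ)
    (hanonneg : ∀ ℓ, 0 ≤ a ℓ)
    (hamono : Antitone a)
    (hgap : ∀ ℓ : ℕ, ∃ c : ℝ, 0 < c ∧ ∀ j : ℕ, j ≠ ℓ → c ≤ |a j - a ℓ|)
    (H₀ : 𝓗 →L[ℝ] 𝓗)
    (hH₀sym : ∀ x y, ⟪H₀ x, y⟫ = ⟪x, H₀ y⟫)
    (hH₀HS : Summable fun n => ‖H₀ (e n)‖ ^ 2) :
    ∃ H : ℝ → 𝓗 →L[ℝ] 𝓗,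
      -- `H` solves the Brockett flow `H' = [H, [H, A]]` on `[0,∞)`
      (H 0 = H₀ ∧
        ∀ t ∈ Ici (0 : ℝ),
          HasDerivWithinAt H
            (H t * (H t * A - A * H t) - (H t * A - A * H t) * H t) (Ici 0) t) ∧
      -- `H(t)` is symmetric Hilbert–Schmidt for all `t ≥ 0`
      (∀ t ∈ Ici (0 : ℝ),
        (∀ x y, ⟪H t x, y⟫ = ⟪x, H t y⟫) ∧ Summable fun n => ‖H t (e n)‖ ^ 2) ∧
      -- uniqueness
      (∀ K : ℝ → 𝓗 →L[ℝ] 𝓗,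
        (K 0 = H₀ ∧
          ∀ t ∈ Ici (0 : ℝ),
            HasDerivWithinAt K
              (K t * (K t * A - A * K t) - (K t * A - A * K t) * K t) (Ici 0) t) →
        ∀ t ∈ Ici (0 : ℝ), K t = H t) ∧
      -- convergence to a diagonal Hilbert–Schmidt operator
      (∃ Hinf : 𝓗 →L[ℝ] 𝓗, ∃ α : ℕ → ℝ,
        (∀ n, Hinf (e n) = α n • e n) ∧
        (Summable fun n => ‖Hinf (e n)‖ ^ 2) ∧
        (∀ x : 𝓗, Tendsto (fun t => H t x) atTop (nhds (Hinf x))) ∧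
        (∀ B : 𝓗 →L[ℝ] 𝓗, (∀ x y, ⟪B x, y⟫ = ⟪x, B y⟫) →
          (Summable fun n => ‖B (e n)‖ ^ 2) →
          Tendsto (fun t => ∑' n, ⟪B (e n), H t (e n)⟫) atTop
            (nhds (∑' n, ⟪B (e n), Hinf (e n)⟫)))) := by
  have hAsa : IsSelfAdjoint A := isSelfAdjoint_of_diagonal e hAdiag
  have hsymm : ∀ T : 𝓗 →L[ℝ] 𝓗, IsSelfAdjoint T ↔ ∀ x y, ⟪T x, y⟫ = ⟪x, T y⟫ := fun T =>
    isSelfAdjoint_iff_isSymmetric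
  have hH₀sa : IsSelfAdjoint H₀ := (hsymm _).2 hH₀sym
  obtain ⟨U, hU0, hUnorm, hU⟩ := exists_brockettField_conjugation (R := 𝓗 →L[ℝ] 𝓗) hAsa hH₀sa
  set H : ℝ → 𝓗 →L[ℝ] 𝓗 := fun t => star (U t) * H₀ * U t with hHdef
  have hH0 : H 0 = H₀ := by simp [hHdef, hU0]
  have hsa : ∀ t, IsSelfAdjoint (H t) := fun t => hH₀sa.conjugate' (U t)
  have hr : ∀ t, ‖H t‖ ≤ ‖H₀‖ := fun t => by
    have hstar : ‖star (U t)‖ ≤ 1 := by simpa [star_eq_adjoint] using hUnorm t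
    calc ‖H t‖ ≤ 1 * ‖H₀‖ * 1 :=
          norm_mul_le_of_le (norm_mul_le_of_le hstar le_rfl) (hUnorm t)
      _ = ‖H₀‖ := by ring
  have hH₀top := (summable_iff_hilbertSchmidtSq_ne_top e H₀).1 hH₀HS
  have hHSle : ∀ t, hilbertSchmidtSq e (H t) ≤ hilbertSchmidtSq e H₀ := fun t =>
    hilbertSchmidtSq_star_mul_mul_le e (hUnorm t)
  have hHS : ∀ t, Summable fun n => ‖H t (e n)‖ ^ 2 := fun t =>
    (summable_iff_hilbertSchmidtSq_ne_top e _).2 (ne_top_of_le_ne_top hH₀top (hHSle t))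
  set M : ℝ := ∑' n, ‖H₀ (e n)‖ ^ 2 with hM
  have hHM : ∀ t, ∑' n, ‖H t (e n)‖ ^ 2 ≤ M := by
    intro t
    have h := hHSle t
    rw [hilbertSchmidtSq, hilbertSchmidtSq,
      ← ENNReal.ofReal_tsum_of_nonneg (fun _ => sq_nonneg _) (hHS t),
      ← ENNReal.ofReal_tsum_of_nonneg (fun _ => sq_nonneg _) hH₀HS] at h
    exact (ENNReal.ofReal_le_ofReal_iff (tsum_nonneg fun _ => sq_nonneg _)).1 h
  choose α hα using exists_tendsto_brockett_basis e hAdiag hamono hgap hsa hr hU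
  obtain ⟨Hinf, hHinf⟩ := exists_tendsto_of_tendsto_basis e hr fun n => ⟨_, hα n⟩
  have hbound : ∀ s : Finset ℕ, ∑ n ∈ s, ‖Hinf (e n)‖ ^ 2 ≤ M := fun s =>
    le_of_tendsto (tendsto_finsetSum s fun n _ => (hHinf (e n)).norm.pow 2)
      (Eventually.of_forall fun t =>
        ((hHS t).sum_le_tsum s fun _ _ => sq_nonneg _).trans (hHM t))
  have hinfHS : Summable fun n => ‖Hinf (e n)‖ ^ 2 :=
    summable_of_sum_le (fun _ => sq_nonneg _) hbound
  have hinfM : ∑' n, ‖Hinf (e n)‖ ^ 2 ≤ M := hinfHS.tsum_le_of_sum_le hbound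
  refine ⟨H, ⟨hH0, fun t _ => (hU t).hasDerivWithinAt⟩,
    fun t _ => ⟨(hsymm _).1 (hsa t), hHS t⟩,
    fun K hK => brockettField_unique (hK.1.trans hH0.symm)
      (fun t _ => (hU t).hasDerivWithinAt) hK.2,
    Hinf, α, fun n => tendsto_nhds_unique (hHinf (e n)) (hα n), hinfHS, hHinf,
    fun B _ hB => ?_⟩
  have hdiff : ∀ t n, ‖H t (e n) - Hinf (e n)‖ ^ 2
      ≤ 2 * ‖H t (e n)‖ ^ 2 + 2 * ‖Hinf (e n)‖ ^ 2 := fun t n => by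
    have := norm_sub_le (H t (e n)) (Hinf (e n))
    nlinarith [sq_nonneg (‖H t (e n)‖ - ‖Hinf (e n)‖), norm_nonneg (H t (e n) - Hinf (e n))]
  have hmaj : ∀ t, Summable fun n => 2 * ‖H t (e n)‖ ^ 2 + 2 * ‖Hinf (e n)‖ ^ 2 := fun t =>
    ((hHS t).mul_left 2).add (hinfHS.mul_left 2)
  have hdS : ∀ t, Summable fun n => ‖H t (e n) - Hinf (e n)‖ ^ 2 := fun t =>
    Summable.of_nonneg_of_le (fun _ => sq_nonneg _) (hdiff t) (hmaj t)
  have hdM : ∀ t, ∑' n, ‖H t (e n) - Hinf (e n)‖ ^ 2 ≤ 4 * M := fun t => by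
    refine ((hdS t).tsum_le_tsum (hdiff t) (hmaj t)).trans ?_
    rw [((hHS t).mul_left 2).tsum_add (hinfHS.mul_left 2), tsum_mul_left, tsum_mul_left]
    linarith [hHM t]
  have hinner : ∀ T : 𝓗 →L[ℝ] 𝓗, (Summable fun n => ‖T (e n)‖ ^ 2) →
      Summable fun n => ⟪B (e n), T (e n)⟫ := fun T hT =>
    Summable.of_norm_bounded (hB.add hT) fun n => by
      refine (norm_inner_le_norm _ _).trans ?_
      nlinarith [sq_nonneg (‖B (e n)‖ - ‖T (e n)‖), sq_nonneg ‖B (e n)‖, sq_nonneg ‖T (e n)‖]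
  have hweak := tendsto_tsum_inner_zero hB hdS hdM fun n => by
    simpa using (hHinf (e n)).sub_const (Hinf (e n))
  have hadd := hweak.add_const (∑' n, ⟪B (e n), Hinf (e n)⟫)
  rw [zero_add] at hadd
  refine hadd.congr fun t => ?_
  simp only [inner_sub_right]
  rw [(hinner _ (hHS t)).tsum_sub (hinner _ hinfHS), sub_add_cancel]
end

section
/- Toda flow: for every H₀ ∈ S₂(H) the Cauchy problem H' = [H, H⁻ − (H⁻)*], H(0) = H₀, where H⁻ is the lower-triangular part of H in the basis (e_n), admits a unique global solution H ∈ C¹([0,∞), S₂(H)) which converges weakly in S₂(H) (and strongly as an operator) as t → +∞ to a diagonal Hilbert–Schmidt operator. -/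
open MeasureTheory Filter Set ContinuousLinearMap
open scoped RealInnerProductSpace

namespace Toda

section

variable {𝓗 : Type*} [NormedAddCommGroup 𝓗]

/-- Square-summable sequences of vectors, thought of as the columns of Hilbert–Schmidt operators. -/
abbrev Columns (𝓗 : Type*) [NormedAddCommGroup 𝓗] : Type _ := lp (fun _ : ℕ => 𝓗) 2

theorem memℓp_two_iff {f : ℕ → 𝓗} : Memℓp f 2 ↔ Summable fun n => ‖f n‖ ^ 2 := by
  rw [memℓp_gen_iff (by norm_num)]
  simp

theorem hasSum_norm_sq (x : Columns 𝓗) : HasSum (fun n => ‖x n‖ ^ 2) (‖x‖ ^ 2) := by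
  simpa using lp.hasSum_norm (p := 2) (by norm_num) x

theorem sum_norm_sq_le (x : Columns 𝓗) (s : Finset ℕ) : ∑ n ∈ s, ‖x n‖ ^ 2 ≤ ‖x‖ ^ 2 :=
  sum_le_hasSum s (fun _ _ => by positivity) (hasSum_norm_sq x)

variable [InnerProductSpace ℝ 𝓗]

theorem sum_norm_sq_map_le (T : ℕ → 𝓗 →L[ℝ] 𝓗) (C : ℝ) (hT : ∀ i v, ‖T i v‖ ≤ C * ‖v‖)
    (x : Columns 𝓗) (i : ℕ) : ‖T i (x i)‖ ^ 2 ≤ C ^ 2 * ‖x i‖ ^ 2 := by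
  have := pow_le_pow_left₀ (norm_nonneg _) (hT i (x i)) 2
  rwa [mul_pow] at this

/-- A uniformly bounded sequence of operators acts columnwise, as a linear map. -/
def mapColumnsₗ (T : ℕ → 𝓗 →L[ℝ] 𝓗) (C : ℝ) (hT : ∀ i v, ‖T i v‖ ≤ C * ‖v‖) :
    Columns 𝓗 →ₗ[ℝ] Columns 𝓗 where
  toFun x := ⟨fun i => T i (x i), memℓp_two_iff.2 <|
    Summable.of_nonneg_of_le (fun _ => by positivity) (sum_norm_sq_map_le T C hT x)
      ((hasSum_norm_sq x).summable.mul_left (C ^ 2))⟩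
  map_add' x y := by ext i; exact map_add (T i) (x i) (y i)
  map_smul' c x := by ext i; exact map_smul (T i) c (x i)

theorem norm_mapColumnsₗ_le (T : ℕ → 𝓗 →L[ℝ] 𝓗) (C : ℝ) (hC : 0 ≤ C)
    (hT : ∀ i v, ‖T i v‖ ≤ C * ‖v‖) (x : Columns 𝓗) : ‖mapColumnsₗ T C hT x‖ ≤ C * ‖x‖ := by
  refine abs_le_of_sq_le_sq' ?_ (by positivity) |>.2
  rw [mul_pow]
  exact hasSum_le (sum_norm_sq_map_le T C hT x) (hasSum_norm_sq (mapColumnsₗ T C hT x))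
    ((hasSum_norm_sq x).mul_left (C ^ 2))

/-- A uniformly bounded sequence of operators acts columnwise. -/
noncomputable def mapColumns (T : ℕ → 𝓗 →L[ℝ] 𝓗) (C : ℝ) (hC : 0 ≤ C)
    (hT : ∀ i v, ‖T i v‖ ≤ C * ‖v‖) : Columns 𝓗 →L[ℝ] Columns 𝓗 :=
  (mapColumnsₗ T C hT).mkContinuous C (norm_mapColumnsₗ_le T C hC hT)

@[simp] theorem mapColumns_apply (T : ℕ → 𝓗 →L[ℝ] 𝓗) (C : ℝ) (hC : 0 ≤ C)
    (hT : ∀ i v, ‖T i v‖ ≤ C * ‖v‖) (x : Columns 𝓗) (i : ℕ) :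
    mapColumns T C hC hT x i = T i (x i) := rfl

theorem norm_mapColumns_le (T : ℕ → 𝓗 →L[ℝ] 𝓗) (C : ℝ) (hC : 0 ≤ C)
    (hT : ∀ i v, ‖T i v‖ ≤ C * ‖v‖) : ‖mapColumns T C hC hT‖ ≤ C :=
  LinearMap.mkContinuous_norm_le _ hC _

/-- Left composition with an operator, on columns. -/
noncomputable def leftMul (A : 𝓗 →L[ℝ] 𝓗) : Columns 𝓗 →L[ℝ] Columns 𝓗 :=
  mapColumns (fun _ => A) ‖A‖ (norm_nonneg _) fun _ => A.le_opNorm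

@[simp] theorem leftMul_apply (A : 𝓗 →L[ℝ] 𝓗) (x : Columns 𝓗) (i : ℕ) :
    leftMul A x i = A (x i) := rfl

theorem norm_leftMul_apply_le (A : 𝓗 →L[ℝ] 𝓗) (x : Columns 𝓗) : ‖leftMul A x‖ ≤ ‖A‖ * ‖x‖ :=
  (leftMul A).le_of_opNorm_le (norm_mapColumns_le _ _ _ _) x

theorem leftMul_sub_apply (A B : 𝓗 →L[ℝ] 𝓗) (x : Columns 𝓗) :
    leftMul (A - B) x = leftMul A x - leftMul B x := by
  ext i
  exact sub_apply A B (x i)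

variable (e : HilbertBasis ℕ ℝ 𝓗)

theorem ext_basis {A B : 𝓗 →L[ℝ] 𝓗} (h : ∀ i, A (e i) = B (e i)) : A = B :=
  ContinuousLinearMap.ext_on (s := Set.range e)
    (by
      have := e.dense_span
      rw [Submodule.dense_iff_topologicalClosure_eq_top]
      exact this) (by rintro _ ⟨i, rfl⟩; exact h i)

theorem ext_vector {v w : 𝓗} (h : ∀ i, ⟪v, e i⟫ = ⟪w, e i⟫) : v = w := by
  apply e.repr.injective
  ext i
  rw [e.repr_apply_apply, e.repr_apply_apply, real_inner_comm, h, real_inner_comm]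

theorem ext_entries {A B : 𝓗 →L[ℝ] 𝓗} (h : ∀ i j, ⟪A (e i), e j⟫ = ⟪B (e i), e j⟫) : A = B :=
  ext_basis e fun i => ext_vector e (h i)

theorem norm_sum_inner_smul_le (x : Columns 𝓗) (v : 𝓗) (s : Finset ℕ) :
    ∑ n ∈ s, ‖⟪e n, v⟫ • x n‖ ≤ ‖x‖ * ‖v‖ := by
  refine abs_le_of_sq_le_sq' ?_ (by positivity) |>.2
  simp only [norm_smul]
  calc _ ≤ (∑ n ∈ s, ‖⟪e n, v⟫‖ ^ 2) * ∑ n ∈ s, ‖x n‖ ^ 2 := Finset.sum_mul_sq_le_sq_mul_sq _ _ _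
    _ ≤ ‖v‖ ^ 2 * ‖x‖ ^ 2 := by
      gcongr
      · exact e.orthonormal.sum_inner_products_le v
      · exact sum_norm_sq_le x s
    _ = _ := by ring

/-- The partial Fourier sum over the first `n` basis vectors. -/
noncomputable def proj (n : ℕ) : 𝓗 →L[ℝ] 𝓗 :=
  ∑ j ∈ Finset.range n, (innerSL ℝ (e j)).smulRight (e j)

theorem proj_apply (n : ℕ) (v : 𝓗) : proj e n v = ∑ j ∈ Finset.range n, ⟪e j, v⟫ • e j := by
  simp [proj]

theorem norm_proj_le (n : ℕ) (v : 𝓗) : ‖proj e n v‖ ≤ ‖v‖ := by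
  refine abs_le_of_sq_le_sq' ?_ (by positivity) |>.2
  rw [proj_apply, ← real_inner_self_eq_norm_sq, e.orthonormal.inner_sum]
  have := e.orthonormal.sum_inner_products_le v (s := Finset.range n)
  simpa [sq] using this

theorem inner_proj_basis (n : ℕ) (v : 𝓗) (j : ℕ) :
    ⟪proj e n v, e j⟫ = if j < n then ⟪v, e j⟫ else 0 := by
  rw [proj_apply, sum_inner]
  simp only [inner_smul_left, orthonormal_iff_ite.1 e.orthonormal]
  simp [real_inner_comm]

/-- The lower-triangular part, on columns. -/
noncomputable def lower : Columns 𝓗 →L[ℝ] Columns 𝓗 :=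
  mapColumns (fun i => ContinuousLinearMap.id ℝ 𝓗 - proj e i) 2 zero_le_two fun i v => by
    have := norm_sub_le v (proj e i v)
    have := norm_proj_le e i v
    simp only [sub_apply, id_apply]
    linarith

theorem inner_lower (x : Columns 𝓗) (i j : ℕ) :
    ⟪lower e x i, e j⟫ = if i ≤ j then ⟪x i, e j⟫ else 0 := by
  simp only [lower, mapColumns_apply, sub_apply, id_apply, inner_sub_left, inner_proj_basis]
  split_ifs <;> first | omega | simp

/-- On columns of symmetric operators, the Toda map `X ↦ X⁻ - (X⁻)*`. -/
noncomputable def gen : Columns 𝓗 →L[ℝ] Columns 𝓗 :=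
  mapColumns (fun i => ContinuousLinearMap.id ℝ 𝓗 - proj e i - proj e (i + 1)) 3 zero_le_three
    fun i v => by
    have := norm_sub_le v (proj e i v)
    have := norm_sub_le (v - proj e i v) (proj e (i + 1) v)
    have := norm_proj_le e i v
    have := norm_proj_le e (i + 1) v
    simp only [sub_apply, id_apply]
    linarith

theorem inner_gen (x : Columns 𝓗) (i j : ℕ) :
    ⟪gen e x i, e j⟫ = if i < j then ⟪x i, e j⟫ else if j < i then -⟪x i, e j⟫ else 0 := by
  simp only [gen, mapColumns_apply, sub_apply, id_apply, inner_sub_left, inner_proj_basis]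
  split_ifs <;> first | omega | simp

/-- The columns of symmetric operators. -/
def symm : Submodule ℝ (Columns 𝓗) where
  carrier := {x | ∀ i j, ⟪x i, e j⟫ = ⟪x j, e i⟫}
  add_mem' := fun {x y} hx hy i j => by simp [inner_add_left, hx i j, hy i j]
  zero_mem' := fun i j => by simp
  smul_mem' := fun c x hx i j => by simp [inner_smul_left, hx i j]

theorem isClosed_symm : IsClosed (symm e : Set (Columns 𝓗)) := by
  have h : (symm e : Set (Columns 𝓗)) = ⋂ i, ⋂ j, {x | ⟪x i, e j⟫ = ⟪x j, e i⟫} := by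
    ext x
    simp [symm]
  rw [h]
  have hc (i : ℕ) : Continuous fun x : Columns 𝓗 => x i :=
    (lp.evalCLM ℝ (fun _ : ℕ => 𝓗) 2 i).continuous
  exact isClosed_iInter fun i => isClosed_iInter fun j =>
    isClosed_eq ((hc i).inner continuous_const) ((hc j).inner continuous_const)

theorem summable_norm_inner_smul (x : Columns 𝓗) (v : 𝓗) :
    Summable fun n => ‖⟪e n, v⟫ • x n‖ :=
  summable_of_sum_le (fun _ => norm_nonneg _) (norm_sum_inner_smul_le e x v)

variable [CompleteSpace 𝓗]

theorem summable_inner_smul (x : Columns 𝓗) (v : 𝓗) : Summable fun n => ⟪e n, v⟫ • x n :=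
  (summable_norm_inner_smul e x v).of_norm

/-- The Hilbert–Schmidt operator with given columns. -/
noncomputable def ofColumns : Columns 𝓗 →L[ℝ] 𝓗 →L[ℝ] 𝓗 :=
  LinearMap.mkContinuous₂
    (LinearMap.mk₂ ℝ (fun x v => ∑' n, ⟪e n, v⟫ • x n)
      (fun x y v => by
        rw [← (summable_inner_smul e x v).tsum_add (summable_inner_smul e y v)]
        simp [smul_add])
      (fun c x v => by
        rw [← (summable_inner_smul e x v).tsum_const_smul]
        simp [smul_comm c])
      (fun x v w => by
        rw [← (summable_inner_smul e x v).tsum_add (summable_inner_smul e x w)]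
        simp [inner_add_right, add_smul])
      (fun c x v => by
        rw [← (summable_inner_smul e x v).tsum_const_smul]
        simp [inner_smul_right, mul_smul]))
    1 (fun x v => by
      rw [one_mul]
      exact (norm_tsum_le_tsum_norm (summable_norm_inner_smul e x v)).trans <|
        (summable_norm_inner_smul e x v).tsum_le_of_sum_le (norm_sum_inner_smul_le e x v))

@[simp] theorem ofColumns_basis (x : Columns 𝓗) (i : ℕ) : ofColumns e x (e i) = x i := by
  change ∑' n, ⟪e n, e i⟫ • x n = x i
  rw [tsum_eq_single i]
  · simp [e.orthonormal.1]
  · intro j hj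
    simp [e.orthonormal.2 hj]

theorem norm_ofColumns_le (x : Columns 𝓗) : ‖ofColumns e x‖ ≤ ‖x‖ := by
  have h : ‖ofColumns e‖ ≤ 1 := LinearMap.mkContinuous₂_norm_le _ zero_le_one _
  simpa using (ofColumns e).le_of_opNorm_le h x

theorem ofColumns_leftMul (A : 𝓗 →L[ℝ] 𝓗) (x : Columns 𝓗) :
    ofColumns e (leftMul A x) = A * ofColumns e x :=
  ext_basis e fun i => by simp

theorem summable_norm_sq_ofColumns (x : Columns 𝓗) :
    Summable fun n => ‖ofColumns e x (e n)‖ ^ 2 := by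
  simpa using (hasSum_norm_sq x).summable

theorem adjoint_ofColumns {x : Columns 𝓗} (hx : x ∈ symm e) :
    adjoint (ofColumns e x) = ofColumns e x :=
  ext_entries e fun i j => by
    rw [adjoint_inner_left, ofColumns_basis, ofColumns_basis, real_inner_comm]
    exact (hx i j).symm

theorem adjoint_ofColumns_gen {x : Columns 𝓗} (hx : x ∈ symm e) :
    adjoint (ofColumns e (gen e x)) = -ofColumns e (gen e x) :=
  ext_entries e fun i j => by
    rw [adjoint_inner_left, neg_apply, inner_neg_left, ofColumns_basis, ofColumns_basis,
      real_inner_comm, inner_gen, inner_gen, hx i j]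
    split_ifs <;> first | omega | simp

theorem ofColumns_gen {x : Columns 𝓗} (hx : x ∈ symm e) :
    ofColumns e (gen e x) = ofColumns e (lower e x) - adjoint (ofColumns e (lower e x)) :=
  ext_entries e fun i j => by
    rw [sub_apply, inner_sub_left, adjoint_inner_left, ofColumns_basis, ofColumns_basis,
      ofColumns_basis, real_inner_comm _ (e i), inner_gen, inner_lower, inner_lower, hx j i]
    split_ifs <;> first | omega | simp

/-- The Toda vector field on columns. -/
noncomputable def field (x : Columns 𝓗) : Columns 𝓗 :=
  leftMul (ofColumns e x) (gen e x) - leftMul (ofColumns e (gen e x)) x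

theorem ofColumns_field {x : Columns 𝓗} :
    ofColumns e (field e x) =
      ofColumns e x * ofColumns e (gen e x) - ofColumns e (gen e x) * ofColumns e x := by
  simp [field, ofColumns_leftMul]

theorem mem_symm_of_adjoint {x : Columns 𝓗} (h : adjoint (ofColumns e x) = ofColumns e x) :
    x ∈ symm e := fun i j => by
  have h' : ⟪adjoint (ofColumns e x) (e i), e j⟫ = ⟪ofColumns e x (e i), e j⟫ := by rw [h]
  rw [adjoint_inner_left, ofColumns_basis, ofColumns_basis, real_inner_comm] at h'
  exact h'.symm

theorem field_mem_symm {x : Columns 𝓗} (hx : x ∈ symm e) : field e x ∈ symm e := by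
  apply mem_symm_of_adjoint
  have h1 := adjoint_ofColumns e hx
  have h2 := adjoint_ofColumns_gen e hx
  rw [ofColumns_field]
  simp only [mul_def] at *
  rw [map_sub, adjoint_comp, adjoint_comp, h1, h2]
  simp only [neg_comp, comp_neg]
  abel

end

section

section GlobalExistence

variable {E : Type*} [NormedAddCommGroup E]

theorem exists_global_of_lipschitz [NormedSpace ℝ E] [CompleteSpace E] {f : E → E} {K : NNReal}
    (hf : LipschitzWith K f) {L : ℝ} (hL : ∀ x, ‖f x‖ ≤ L) (x₀ : E) :
    ∃ γ : ℝ → E, γ 0 = x₀ ∧ ∀ t ∈ Ici (0 : ℝ), HasDerivWithinAt γ (f (γ t)) (Ici 0) t := by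
  have hL0 : 0 ≤ L := (norm_nonneg _).trans (hL x₀)
  have hex (n : ℕ) : ∃ α : ℝ → E, α 0 = x₀ ∧
      ∀ t ∈ Icc (0 : ℝ) n, HasDerivWithinAt α (f (α t)) (Icc 0 n) t := by
    have hpl : IsPicardLindelof (fun _ => f) (⟨0, by simp⟩ : Icc (0 : ℝ) n) x₀
        (L.toNNReal * n) 0 L.toNNReal K :=
      IsPicardLindelof.of_time_independent
        (fun x _ => by rw [Real.coe_toNNReal _ hL0]; exact hL x) hf.lipschitzOnWith (by simp)
    exact hpl.exists_eq_forall_mem_Icc_hasDerivWithinAt₀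
  choose α hα0 hα using hex
  have hright {n : ℕ} {t : ℝ} (h0 : 0 ≤ t) (hn : t < n) :
      HasDerivWithinAt (α n) (f (α n t)) (Ici t) t :=
    (hα n t ⟨h0, hn.le⟩).mono_of_mem_nhdsWithin <| by
      filter_upwards [Icc_mem_nhdsGE hn] with s hs
      exact ⟨h0.trans hs.1, hs.2⟩
  have hagree {m n : ℕ} (hmn : m ≤ n) : EqOn (α m) (α n) (Icc 0 m) := by
    have hmn' : (m : ℝ) ≤ n := by exact_mod_cast hmn
    refine ODE_solution_unique (v := fun _ => f) (fun _ => hf)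
      (fun t ht => (hα m t ht).continuousWithinAt) (fun t ht => hright ht.1 ht.2)
      (fun t ht => (hα n t ⟨ht.1, ht.2.trans hmn'⟩).continuousWithinAt.mono
        (Icc_subset_Icc_right hmn')) (fun t ht => hright ht.1 (ht.2.trans_le hmn')) ?_
    rw [hα0, hα0]
  have hlt (t : ℝ) : t < (⌈t⌉₊ + 1 : ℕ) := by
    push_cast
    exact (Nat.le_ceil t).trans_lt (lt_add_one _)
  refine ⟨fun t => α (⌈t⌉₊ + 1) t, hα0 _, fun t ht => ?_⟩
  have ht' : (0 : ℝ) ≤ t := ht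
  have heq {s : ℝ} {n : ℕ} (hs : 0 ≤ s) (hn : s ≤ n) : α (⌈s⌉₊ + 1) s = α n s := by
    rcases le_total (⌈s⌉₊ + 1) n with h | h
    · exact hagree h ⟨hs, (hlt s).le⟩
    · exact (hagree h ⟨hs, hn⟩).symm
  have hnhds : Icc (0 : ℝ) (⌈t⌉₊ + 1 : ℕ) ∈ nhdsWithin t (Ici 0) := by
    rw [mem_nhdsWithin_iff_exists_mem_nhds_inter]
    exact ⟨Iic _, Iic_mem_nhds (hlt t), fun s hs => ⟨hs.2, hs.1⟩⟩
  refine ((hα (⌈t⌉₊ + 1) t ⟨ht', (hlt t).le⟩).mono_of_mem_nhdsWithin hnhds).congr_of_eventuallyEq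
    ?_ rfl
  filter_upwards [hnhds] with s hs
  exact heq hs.1 hs.2

/-- Radial retraction onto the closed ball of radius `R`. -/
noncomputable def retract [NormedSpace ℝ E] (R : ℝ) (x : E) : E := (R / max R ‖x‖) • x

variable [NormedSpace ℝ E] {R : ℝ}

theorem norm_retract_le (hR : 0 < R) (x : E) : ‖retract R x‖ ≤ R := by
  have h : 0 < max R ‖x‖ := hR.trans_le (le_max_left _ _)
  rw [retract, norm_smul, Real.norm_of_nonneg (by positivity), div_mul_eq_mul_div, div_le_iff₀ h]
  gcongr
  exact le_max_right _ _

theorem retract_of_norm_le (hR : 0 < R) {x : E} (hx : ‖x‖ ≤ R) : retract R x = x := by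
  rw [retract, max_eq_left hx, div_self hR.ne', one_smul]

theorem lipschitzWith_retract (hR : 0 < R) : LipschitzWith 2 (retract R : E → E) := by
  refine LipschitzWith.of_dist_le_mul fun x y => ?_
  rw [dist_eq_norm, dist_eq_norm]
  set a := max R ‖x‖ with ha
  set b := max R ‖y‖ with hb
  have ha0 : 0 < a := hR.trans_le (le_max_left _ _)
  have hb0 : 0 < b := hR.trans_le (le_max_left _ _)
  have hab : |b - a| ≤ ‖x - y‖ := by
    rw [abs_sub_comm, ha, hb]
    refine (abs_max_sub_max_le_max R ‖x‖ R ‖y‖).trans ?_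
    simpa using abs_norm_sub_norm_le x y
  have hsplit : retract R x - retract R y = (R / a) • (x - y) + (R / a * ((b - a) / b)) • y := by
    simp only [retract, ← ha, ← hb]
    have : R / a * ((b - a) / b) = R / a - R / b := by field_simp
    rw [this]
    module
  rw [hsplit]
  refine (norm_add_le _ _).trans ?_
  rw [norm_smul, norm_smul, norm_mul, norm_div (b - a), Real.norm_of_nonneg (by positivity),
    Real.norm_of_nonneg hb0.le, Real.norm_eq_abs]
  have hRa : R / a ≤ 1 := div_le_one_of_le₀ (le_max_left _ _) ha0.le
  have hy : |b - a| / b * ‖y‖ ≤ |b - a| := by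
    rw [div_mul_eq_mul_div, div_le_iff₀ hb0]
    gcongr
    exact le_max_right _ _
  have h1 : R / a * ‖x - y‖ ≤ ‖x - y‖ := mul_le_of_le_one_left (norm_nonneg _) hRa
  have h2 : R / a * (|b - a| / b) * ‖y‖ ≤ |b - a| := by
    rw [mul_assoc]
    exact (mul_le_of_le_one_left (by positivity) hRa).trans hy
  simp only [NNReal.coe_ofNat]
  linarith

theorem exists_global_of_inner_eq_zero {E : Type*} [NormedAddCommGroup E] [InnerProductSpace ℝ E]
    [CompleteSpace E] {f : E → E} (hf : ∀ R : ℝ, ∃ K, LipschitzOnWith K f (Metric.closedBall 0 R))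
    (horth : ∀ x, ⟪x, f x⟫ = 0) (x₀ : E) :
    ∃ γ : ℝ → E, γ 0 = x₀ ∧ (∀ t ∈ Ici (0 : ℝ), HasDerivWithinAt γ (f (γ t)) (Ici 0) t) ∧
      ∀ t ∈ Ici (0 : ℝ), ‖γ t‖ = ‖x₀‖ := by
  set R := ‖x₀‖ + 1 with hRdef
  have hR : 0 < R := by positivity
  obtain ⟨K, hK⟩ := hf R
  have hmaps : ∀ x : E, retract R x ∈ Metric.closedBall (0 : E) R := fun x => by
    simpa using norm_retract_le hR x
  have hlip : LipschitzWith (K * 2) (f ∘ retract R) := by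
    rw [← lipschitzOnWith_univ]
    exact hK.comp (lipschitzWith_retract hR).lipschitzOnWith fun x _ => hmaps x
  have hbdd (x : E) : ‖(f ∘ retract R) x‖ ≤ ‖f 0‖ + K * R := by
    have h := hK.dist_le_mul _ (hmaps x) 0 (by simpa using hR.le)
    rw [dist_eq_norm, dist_zero_right] at h
    have h1 := norm_le_norm_add_norm_sub' (f (retract R x)) (f 0)
    have h2 : (K : ℝ) * ‖retract R x‖ ≤ K * R := by gcongr; exact norm_retract_le hR x
    simp only [Function.comp]
    linarith
  have horth' (x : E) : ⟪x, f (retract R x)⟫ = 0 := by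
    have hc : R / max R ‖x‖ ≠ 0 := (div_pos hR (hR.trans_le (le_max_left _ _))).ne'
    have h := horth (retract R x)
    rw [retract, real_inner_smul_left] at h
    exact (mul_eq_zero.1 h).resolve_left hc
  obtain ⟨γ, h0, hγ⟩ := exists_global_of_lipschitz hlip hbdd x₀
  have hnorm : ∀ t ∈ Ici (0 : ℝ), ‖γ t‖ = ‖x₀‖ := fun t ht => by
    have hd : ∀ s ∈ Ici (0 : ℝ), HasDerivWithinAt (fun s => ‖γ s‖ ^ 2) 0 (Ici 0) s :=
      fun s hs => by
        have h := (hγ s hs).norm_sq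
        rwa [Function.comp_apply, horth', mul_zero] at h
    have h := constant_of_has_deriv_right_zero (f := fun s => ‖γ s‖ ^ 2) (a := 0) (b := t)
      (fun s hs => (hd s hs.1).continuousWithinAt.mono Icc_subset_Ici_self)
      (fun s hs => (hd s hs.1).mono (Ici_subset_Ici.2 hs.1)) t ⟨ht, le_rfl⟩
    rw [h0] at h
    exact (pow_left_inj₀ (norm_nonneg _) (norm_nonneg _) two_ne_zero).1 h
  refine ⟨γ, h0, fun t ht => ?_, hnorm⟩
  have h := hγ t ht
  rwa [Function.comp_apply, retract_of_norm_le hR (by rw [hnorm t ht]; linarith)] at h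

end GlobalExistence

variable {𝓗 : Type*} [NormedAddCommGroup 𝓗] [InnerProductSpace ℝ 𝓗] (e : HilbertBasis ℕ ℝ 𝓗)

theorem hasSum_inner_sq (v : 𝓗) : HasSum (fun j => ⟪v, e j⟫ ^ 2) (‖v‖ ^ 2) := by
  have h := e.hasSum_inner_mul_inner v v
  rw [real_inner_self_eq_norm_sq] at h
  simpa only [sq, real_inner_comm v] using h

theorem ofReal_norm_sq_columns (x : Columns 𝓗) :
    ENNReal.ofReal (‖x‖ ^ 2) = ∑' i, ∑' j, ENNReal.ofReal (⟪x i, e j⟫ ^ 2) := by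
  rw [← (hasSum_norm_sq x).tsum_eq,
    ENNReal.ofReal_tsum_of_nonneg (fun _ => by positivity) (hasSum_norm_sq x).summable]
  refine tsum_congr fun i => ?_
  rw [← (hasSum_inner_sq e (x i)).tsum_eq,
    ENNReal.ofReal_tsum_of_nonneg (fun _ => by positivity) (hasSum_inner_sq e (x i)).summable]

/-- The Hilbert–Schmidt norm is invariant under transposition. -/
theorem norm_sq_eq_of_transpose {x y : Columns 𝓗} (h : ∀ i j, ⟪x i, e j⟫ = ⟪y j, e i⟫) :
    ‖x‖ ^ 2 = ‖y‖ ^ 2 := by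
  rw [← ENNReal.ofReal_eq_ofReal_iff (by positivity) (by positivity), ofReal_norm_sq_columns e x,
    ofReal_norm_sq_columns e y, ENNReal.tsum_comm]
  simp only [h]

theorem inner_eq_zero_of_symm_of_antisymm {a b : Columns 𝓗} (ha : a ∈ symm e)
    (hb : ∀ i j, ⟪b i, e j⟫ = -⟪b j, e i⟫) : ⟪a, b⟫ = 0 := by
  have h := norm_sq_eq_of_transpose e (x := a + b) (y := a - b) fun i j => by
    simp only [lp.coeFn_add, lp.coeFn_sub, Pi.add_apply, Pi.sub_apply, inner_add_left,
      inner_sub_left, ha i j, hb i j]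
    ring
  rw [norm_add_sq_real, norm_sub_sq_real] at h
  linarith

theorem norm_gen_le (x : Columns 𝓗) : ‖gen e x‖ ≤ 3 * ‖x‖ :=
  (gen e).le_of_opNorm_le (norm_mapColumns_le _ _ _ _) x

variable [CompleteSpace 𝓗]

theorem inner_field_self {x : Columns 𝓗} (hx : x ∈ symm e) : ⟪x, field e x⟫ = 0 := by
  have hX := adjoint_ofColumns e hx
  have hG := adjoint_ofColumns_gen e hx
  have h1 : ⟪x, leftMul (ofColumns e x) (gen e x)⟫ = 0 := by
    have hsq : leftMul (ofColumns e x) x ∈ symm e := fun i j => by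
      rw [leftMul_apply, leftMul_apply, ← adjoint_inner_right, ← adjoint_inner_right, hX,
        ofColumns_basis, ofColumns_basis, real_inner_comm]
    rw [← inner_eq_zero_of_symm_of_antisymm e hsq (b := gen e x) fun i j => by
      rw [inner_gen, inner_gen, hx i j]
      split_ifs <;> first | omega | simp]
    rw [lp.inner_eq_tsum, lp.inner_eq_tsum]
    refine tsum_congr fun i => ?_
    rw [leftMul_apply, leftMul_apply, ← adjoint_inner_left, hX]
  have h2 : ⟪x, leftMul (ofColumns e (gen e x)) x⟫ = 0 := by
    rw [lp.inner_eq_tsum]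
    have h (v : 𝓗) : ⟪v, ofColumns e (gen e x) v⟫ = 0 := by
      have h := adjoint_inner_left (ofColumns e (gen e x)) v v
      rw [hG, neg_apply, inner_neg_left, real_inner_comm] at h
      linarith
    simp [h]
  rw [field, inner_sub_right, h1, h2, sub_zero]

theorem norm_leftMul_ofColumns_le (x y : Columns 𝓗) :
    ‖leftMul (ofColumns e x) y‖ ≤ ‖x‖ * ‖y‖ :=
  (norm_leftMul_apply_le _ _).trans (by gcongr; exact norm_ofColumns_le e x)

theorem norm_field_sub_le (x y : Columns 𝓗) :
    ‖field e x - field e y‖ ≤ 6 * (‖x‖ + ‖y‖) * ‖x - y‖ := by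
  have hsplit : field e x - field e y =
      leftMul (ofColumns e x) (gen e (x - y)) + leftMul (ofColumns e (x - y)) (gen e y) -
      (leftMul (ofColumns e (gen e x)) (x - y) + leftMul (ofColumns e (gen e (x - y))) y) := by
    simp only [field, map_sub, leftMul_sub_apply]
    abel
  rw [hsplit]
  have h1 := norm_leftMul_ofColumns_le e x (gen e (x - y))
  have h2 := norm_leftMul_ofColumns_le e (x - y) (gen e y)
  have h3 := norm_leftMul_ofColumns_le e (gen e x) (x - y)
  have h4 := norm_leftMul_ofColumns_le e (gen e (x - y)) y
  have g1 : ‖x‖ * ‖gen e (x - y)‖ ≤ ‖x‖ * (3 * ‖x - y‖) := by gcongr; exact norm_gen_le e _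
  have g2 : ‖x - y‖ * ‖gen e y‖ ≤ ‖x - y‖ * (3 * ‖y‖) := by gcongr; exact norm_gen_le e _
  have g3 : ‖gen e x‖ * ‖x - y‖ ≤ (3 * ‖x‖) * ‖x - y‖ := by gcongr; exact norm_gen_le e _
  have g4 : ‖gen e (x - y)‖ * ‖y‖ ≤ (3 * ‖x - y‖) * ‖y‖ := by gcongr; exact norm_gen_le e _
  refine (norm_sub_le _ _).trans ((add_le_add (norm_add_le _ _) (norm_add_le _ _)).trans ?_)
  linarith

theorem norm_field_le (x : Columns 𝓗) : ‖field e x‖ ≤ 6 * ‖x‖ ^ 2 := by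
  have h := norm_field_sub_le e x 0
  have h0 : field e 0 = 0 := by simp [field]
  rw [h0, sub_zero, sub_zero, norm_zero] at h
  linarith

theorem exists_columns_flow {x₀ : Columns 𝓗} (hx₀ : x₀ ∈ symm e) :
    ∃ γ : ℝ → Columns 𝓗, γ 0 = x₀ ∧
      (∀ t ∈ Ici (0 : ℝ), HasDerivWithinAt γ (field e (γ t)) (Ici 0) t) ∧
      (∀ t, γ t ∈ symm e) ∧ ∀ t, ‖γ t‖ = ‖x₀‖ := by
  have : CompleteSpace (symm e) := (isClosed_symm e).completeSpace_coe
  obtain ⟨γ, h0, hγ, hn⟩ := exists_global_of_inner_eq_zero (E := symm e)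
    (f := fun x => ⟨field e x, field_mem_symm e x.2⟩)
    (fun R => ⟨(12 * R).toNNReal, LipschitzOnWith.of_dist_le_mul fun x hx y hy => by
      rw [mem_closedBall_zero_iff] at hx hy
      rw [dist_eq_norm, dist_eq_norm]
      refine (norm_field_sub_le e x y).trans ?_
      rw [Real.coe_toNNReal _ (by linarith [norm_nonneg x])]
      change ‖(x : Columns 𝓗)‖ ≤ R at hx
      change ‖(y : Columns 𝓗)‖ ≤ R at hy
      exact mul_le_mul_of_nonneg_right (by linarith) (norm_nonneg _)⟩)
    (fun x => inner_field_self e x.2) ⟨x₀, hx₀⟩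
  have hmax {t : ℝ} (ht : t ∈ Ici (0 : ℝ)) : max t 0 = t := max_eq_left ht
  refine ⟨fun t => γ (max t 0), by simp [h0], fun t ht => ?_, fun t => (γ _).2,
    fun t => hn _ (le_max_right t 0)⟩
  have h := (symm e).subtypeL.hasFDerivAt.comp_hasDerivWithinAt t (hγ t ht)
  refine (h.congr (fun s hs => ?_) ?_).congr_deriv ?_
  · simp [hmax hs]
  · simp [hmax ht]
  · simp [hmax ht]

end

section

/-- A Grönwall lemma for an infinite hierarchy of equations, in weighted sup norm. -/
theorem eq_zero_of_hierarchy {ι : Type*} {f f' : ι → ℝ → ℝ} {w : ι → ℝ} {B C T : ℝ}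
    (hf0 : ∀ i, f i 0 = 0)
    (hf : ∀ i, ∀ t ∈ Icc 0 T, HasDerivWithinAt (f i) (f' i t) (Ici 0) t)
    (hB : ∀ i, ∀ t ∈ Icc 0 T, |f i t| ≤ B * w i)
    (hf' : ∀ t ∈ Icc 0 T, ∀ b, (∀ j, |f j t| ≤ b * w j) → ∀ i, |f' i t| ≤ C * b * w i) :
    ∀ i, ∀ t ∈ Icc 0 T, f i t = 0 := by
  have key (k : ℕ) : ∀ i, ∀ t ∈ Icc 0 T, |f i t| ≤ B * ((C * t) ^ k / k.factorial) * w i := by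
    induction k with
    | zero => simpa using hB
    | succ k ih =>
      intro i t ht
      have hder (s : ℝ) : HasDerivAt
          (fun s => B * ((C * s) ^ (k + 1) / (k + 1).factorial) * w i)
          (C * (B * ((C * s) ^ k / k.factorial)) * w i) s := by
        have h := (((((hasDerivAt_id s).const_mul C).pow (k + 1)).div_const
          ((k + 1).factorial : ℝ)).const_mul B).mul_const (w i)
        refine h.congr_deriv ?_
        have hk : ((k : ℝ) + 1) ≠ 0 := by positivity
        have hk' : (k.factorial : ℝ) ≠ 0 := by positivity
        rw [Nat.factorial_succ]
        push_cast
        simp only [id]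
        field_simp
      exact image_norm_le_of_norm_deriv_right_le_deriv_boundary
        (fun s hs => (hf i s hs).continuousWithinAt.mono Icc_subset_Ici_self)
        (fun s hs => (hf i s ⟨hs.1, hs.2.le⟩).mono (Ici_subset_Ici.2 hs.1))
        (by simp [hf0 i]) hder
        (fun s hs => hf' s ⟨hs.1, hs.2.le⟩ _ (fun j => ih j s ⟨hs.1, hs.2.le⟩) i) ht
  intro i t ht
  have hlim : Tendsto (fun k : ℕ => B * ((C * t) ^ k / k.factorial) * w i) atTop (nhds 0) := by
    simpa using ((FloorSemiring.tendsto_pow_div_factorial_atTop (C * t)).const_mul B).mul_const (w i)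
  exact abs_nonpos_iff.1 (ge_of_tendsto' hlim fun k => key k i t ht)

/-- The coefficients of the upper-triangular part of `K - G`, where `G` is the Toda generator,
in terms of the entries of words in `K` and its adjoint. -/
def upperCoeff (M : List Bool → ℕ → ℕ → ℝ) (l i : ℕ) : ℝ :=
  (if l < i then M [false] i l else 0) + if l ≤ i then M [false] l i else 0

/-- The right-hand side of the hierarchy satisfied by the entries of words. -/
def hierarchyRHS (N : ℕ) (M : List Bool → ℕ → ℕ → ℝ) (W : List Bool) (i j : ℕ) : ℝ :=
  M (W ++ [false]) i j + M (true :: W) i j - ∑ l ∈ Finset.range N, upperCoeff M l i * M W l j -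
    ∑ l ∈ Finset.range N, upperCoeff M l j * M W i l

theorem abs_upperCoeff_le {N : ℕ} {M : List Bool → ℕ → ℕ → ℝ} {b : ℝ}
    (h : ∀ i < N, ∀ j < N, |M [false] i j| ≤ b) {l i : ℕ} (hl : l < N) (hi : i < N) :
    |upperCoeff M l i| ≤ 2 * b := by
  have hb : 0 ≤ b := (abs_nonneg _).trans (h l hl i hi)
  have h1 := h i hi l hl
  have h2 := h l hl i hi
  rw [upperCoeff, two_mul]
  refine (abs_add_le _ _).trans (add_le_add ?_ ?_) <;> split_ifs <;> simpa

theorem abs_sum_upperCoeff_sub_le {N : ℕ} {M M' : List Bool → ℕ → ℕ → ℝ} {p p' : ℕ → ℝ}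
    {R b S : ℝ} (hM' : ∀ i < N, ∀ j < N, |M' [false] i j| ≤ R)
    (hd : ∀ i < N, ∀ j < N, |M [false] i j - M' [false] i j| ≤ b * R)
    (hp : ∀ l < N, |p l| ≤ S) (hpd : ∀ l < N, |p l - p' l| ≤ b * S) {i : ℕ} (hi : i < N) :
    |∑ l ∈ Finset.range N, upperCoeff M l i * p l - ∑ l ∈ Finset.range N, upperCoeff M' l i * p' l|
      ≤ N * (4 * R * b * S) := by
  rw [← Finset.sum_sub_distrib]
  refine (Finset.abs_sum_le_sum_abs _ _).trans ?_
  refine (Finset.sum_le_card_nsmul _ _ (4 * R * b * S) fun l hl => ?_).trans (by simp)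
  rw [Finset.mem_range] at hl
  have h1 : |upperCoeff M l i - upperCoeff M' l i| ≤ 2 * (b * R) := by
    have h := abs_upperCoeff_le (M := fun W i j => M W i j - M' W i j) hd hl hi
    convert h using 2
    simp only [upperCoeff]
    split_ifs <;> ring
  have h2 := abs_upperCoeff_le hM' hl hi
  have hsplit : upperCoeff M l i * p l - upperCoeff M' l i * p' l =
    (upperCoeff M l i - upperCoeff M' l i) * p l + upperCoeff M' l i * (p l - p' l) := by ring
  rw [hsplit]
  refine (abs_add_le _ _).trans ?_
  rw [abs_mul, abs_mul]
  have h3 := mul_le_mul h1 (hp l hl) (abs_nonneg _) ((abs_nonneg _).trans h1)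
  have h4 := mul_le_mul h2 (hpd l hl) (abs_nonneg _) ((abs_nonneg _).trans h2)
  linarith

theorem abs_hierarchyRHS_sub_le {N : ℕ} {M M' : List Bool → ℕ → ℕ → ℝ} {R b : ℝ}
    (hM : ∀ W, ∀ i < N, ∀ j < N, |M W i j| ≤ R ^ W.length)
    (hM' : ∀ W, ∀ i < N, ∀ j < N, |M' W i j| ≤ R ^ W.length)
    (hd : ∀ W, ∀ i < N, ∀ j < N, |M W i j - M' W i j| ≤ b * R ^ W.length)
    (W : List Bool) {i j : ℕ} (hi : i < N) (hj : j < N) :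
    |hierarchyRHS N M W i j - hierarchyRHS N M' W i j| ≤
      (2 + 8 * N) * R * b * R ^ W.length := by
  have h1 := hd (W ++ [false]) i hi j hj
  have h2 := hd (true :: W) i hi j hj
  rw [List.length_append, List.length_singleton, pow_succ] at h1
  rw [List.length_cons, pow_succ] at h2
  have hM1 := fun i hi j hj => hM' [false] i hi j hj
  have hd1 := fun i hi j hj => hd [false] i hi j hj
  simp only [List.length_singleton, pow_one] at hM1 hd1
  have h3 := abs_sum_upperCoeff_sub_le hM1 hd1 (p := fun l => M W l j) (p' := fun l => M' W l j)
    (fun l hl => hM W l hl j hj) (fun l hl => hd W l hl j hj) hi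
  have h4 := abs_sum_upperCoeff_sub_le hM1 hd1 (p := fun l => M W i l) (p' := fun l => M' W i l)
    (fun l hl => hM W i hi l hl) (fun l hl => hd W i hi l hl) hj
  simp only [hierarchyRHS]
  rw [abs_le] at *
  constructor <;> linarith

variable {𝓗 : Type*} [NormedAddCommGroup 𝓗] [InnerProductSpace ℝ 𝓗] [CompleteSpace 𝓗]

/-- The product of a word in `A` (letter `false`) and its adjoint (letter `true`). -/
noncomputable def word (A : 𝓗 →L[ℝ] 𝓗) (W : List Bool) : 𝓗 →L[ℝ] 𝓗 :=
  (W.map fun b => if b then star A else A).prod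

theorem norm_word_le {A : 𝓗 →L[ℝ] 𝓗} {R : ℝ} (hA : ‖A‖ ≤ R) (W : List Bool) :
    ‖word A W‖ ≤ R ^ W.length := by
  induction W with
  | nil =>
    simp only [word, List.map_nil, List.prod_nil, List.length_nil, pow_zero]
    exact norm_id_le
  | cons b W ih =>
    have hb : ‖(if b then star A else A)‖ ≤ R := by
      split_ifs
      · rwa [star_eq_adjoint, LinearIsometryEquiv.norm_map]
      · exact hA
    simp only [word, List.map_cons, List.prod_cons, List.length_cons, pow_succ'] at ih ⊢
    exact (norm_mul_le _ _).trans
      (mul_le_mul hb ih (norm_nonneg _) ((norm_nonneg _).trans hb))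

theorem hasDerivWithinAt_word {K : ℝ → 𝓗 →L[ℝ] 𝓗} {G : 𝓗 →L[ℝ] 𝓗} (hG : star G = -G) {s : Set ℝ}
    {t : ℝ} (hK : HasDerivWithinAt K (K t * G - G * K t) s t) (W : List Bool) :
    HasDerivWithinAt (fun t => word (K t) W) (word (K t) W * G - G * word (K t) W) s t := by
  induction W with
  | nil => simpa [word] using hasDerivWithinAt_const t s (1 : 𝓗 →L[ℝ] 𝓗)
  | cons b W ih =>
    have hb : HasDerivWithinAt (fun t => if b then star (K t) else K t)
        ((if b then star (K t) else K t) * G - G * (if b then star (K t) else K t)) s t := by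
      cases b
      · simpa using hK
      · simpa [hG, sub_eq_add_neg, add_comm] using hK.star
    have h := hb.mul ih
    simp only [word, List.map_cons, List.prod_cons] at h ⊢
    refine h.congr_deriv ?_
    noncomm_ring

variable (e : HilbertBasis ℕ ℝ 𝓗)

/-- The entries of words in an operator and its adjoint. -/
noncomputable def entry (A : 𝓗 →L[ℝ] 𝓗) (W : List Bool) (i j : ℕ) : ℝ := ⟪word A W (e i), e j⟫

theorem abs_entry_le {A : 𝓗 →L[ℝ] 𝓗} {R : ℝ} (hA : ‖A‖ ≤ R) (W : List Bool) (i j : ℕ) :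
    |entry e A W i j| ≤ R ^ W.length := by
  refine (abs_real_inner_le_norm _ _).trans ?_
  rw [e.orthonormal.1, mul_one]
  simpa [e.orthonormal.1] using (word A W).le_of_opNorm_le (norm_word_le hA W) (e i)

/-- `L` is the lower-triangular part of `K`. -/
def IsLower (L K : 𝓗 →L[ℝ] 𝓗) : Prop :=
  ∀ i j : ℕ, ⟪L (e i), e j⟫ = if i ≤ j then ⟪K (e i), e j⟫ else 0

variable {e}

theorem IsLower.sub_adjoint_basis {K L : 𝓗 →L[ℝ] 𝓗} (h : IsLower e L K) {N i : ℕ} (hi : i < N) :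
    (L - adjoint L) (e i) =
      K (e i) - ∑ l ∈ Finset.range N, upperCoeff (entry e K) l i • e l := by
  refine ext_vector e fun j => ?_
  rw [sub_apply, inner_sub_left, inner_sub_left, adjoint_inner_left, real_inner_comm _ (e i), h i j,
    h j i, sum_inner]
  simp only [inner_smul_left, orthonormal_iff_ite.1 e.orthonormal, upperCoeff, entry, word]
  rcases lt_trichotomy i j with hij | hij | hij
  · simp [hij.le, hij.not_ge, hij.not_gt]
  · subst hij
    simp [hi]
  · simp [hij.le, hij.not_ge, hij, hij.trans hi]

theorem hasDerivWithinAt_entry {K : ℝ → 𝓗 →L[ℝ] 𝓗} {L : 𝓗 →L[ℝ] 𝓗} {t : ℝ} {s : Set ℝ}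
    (hL : IsLower e L (K t))
    (hK : HasDerivWithinAt K (K t * (L - adjoint L) - (L - adjoint L) * K t) s t) (W : List Bool)
    {N i j : ℕ} (hi : i < N) (hj : j < N) :
    HasDerivWithinAt (fun t => entry e (K t) W i j) (hierarchyRHS N (entry e (K t)) W i j) s t := by
  have hG : star (L - adjoint L) = -(L - adjoint L) := by
    rw [← star_eq_adjoint, star_sub, star_star, neg_sub]
  have h := ((hasDerivWithinAt_word hG hK W).clm_apply (hasDerivWithinAt_const t s (e i))).inner ℝ
    (hasDerivWithinAt_const t s (e j))
  refine h.congr_deriv ?_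
  have hadj (v : 𝓗) : ⟪(L - adjoint L) v, e j⟫ = -⟪v, (L - adjoint L) (e j)⟫ := by
    rw [← adjoint_inner_right, ← star_eq_adjoint (L - adjoint L), hG, neg_apply, inner_neg_right]
  have hword1 : word (K t) (W ++ [false]) = word (K t) W * K t := by simp [word]
  have hword2 : word (K t) (true :: W) = adjoint (K t) * word (K t) W := by
    simp [word, star_eq_adjoint]
  have hmul (A B : 𝓗 →L[ℝ] 𝓗) (v : 𝓗) : (A * B) v = A (B v) := rfl
  simp only [map_zero, add_zero, inner_zero_right, zero_add, sub_apply (_ * _), hmul,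
    inner_sub_left, hadj, hL.sub_adjoint_basis hi, hL.sub_adjoint_basis hj, hierarchyRHS, entry,
    hword1, hword2, adjoint_inner_left, map_sub, map_sum, map_smul, inner_sub_right, sum_inner,
    inner_sum, inner_smul_left, inner_smul_right, conj_trivial]
  ring

theorem toda_unique {K Km L Lm : ℝ → 𝓗 →L[ℝ] 𝓗}
    (hKm : ∀ t, IsLower e (Km t) (K t)) (hLm : ∀ t, IsLower e (Lm t) (L t))
    (hK : ∀ t ∈ Ici (0 : ℝ), HasDerivWithinAt K
      (K t * (Km t - adjoint (Km t)) - (Km t - adjoint (Km t)) * K t) (Ici 0) t)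
    (hL : ∀ t ∈ Ici (0 : ℝ), HasDerivWithinAt L
      (L t * (Lm t - adjoint (Lm t)) - (Lm t - adjoint (Lm t)) * L t) (Ici 0) t)
    (h0 : K 0 = L 0) {T : ℝ} (hT : 0 ≤ T) : K T = L T := by
  have hbound {K K' : ℝ → 𝓗 →L[ℝ] 𝓗}
      (hK : ∀ t ∈ Ici (0 : ℝ), HasDerivWithinAt K (K' t) (Ici 0) t) :
      ∃ R, ∀ t ∈ Icc 0 T, ‖K t‖ ≤ R :=
    isCompact_Icc.exists_bound_of_continuousOn fun t ht =>
      (hK t ht.1).continuousWithinAt.mono Icc_subset_Ici_self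
  obtain ⟨R₁, hR₁⟩ := hbound hK
  obtain ⟨R₂, hR₂⟩ := hbound hL
  set R := max R₁ R₂
  have hKR (t) (ht : t ∈ Icc 0 T) : ‖K t‖ ≤ R := (hR₁ t ht).trans (le_max_left _ _)
  have hLR (t) (ht : t ∈ Icc 0 T) : ‖L t‖ ≤ R := (hR₂ t ht).trans (le_max_right _ _)
  have hR : 0 ≤ R := (norm_nonneg _).trans (hKR 0 ⟨le_rfl, hT⟩)
  refine ext_entries e fun i j => ?_
  set N := max i j + 1
  have h := eq_zero_of_hierarchy (ι := List Bool × Fin N × Fin N)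
    (f := fun p t => entry e (K t) p.1 p.2.1 p.2.2 - entry e (L t) p.1 p.2.1 p.2.2)
    (w := fun p => R ^ p.1.length) (B := 2) (C := (2 + 8 * N) * R) (T := T)
    (fun p => by rw [h0, sub_self])
    (fun p t ht => (hasDerivWithinAt_entry (hKm t) (hK t ht.1) p.1 p.2.1.2 p.2.2.2).sub
      (hasDerivWithinAt_entry (hLm t) (hL t ht.1) p.1 p.2.1.2 p.2.2.2))
    (fun p t ht => (abs_sub _ _).trans (by
      have h1 := abs_entry_le e (hKR t ht) p.1 p.2.1 p.2.2
      have h2 := abs_entry_le e (hLR t ht) p.1 p.2.1 p.2.2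
      linarith))
    (fun t ht b hb p => abs_hierarchyRHS_sub_le
      (fun W i _ j _ => abs_entry_le e (hKR t ht) W i j)
      (fun W i _ j _ => abs_entry_le e (hLR t ht) W i j)
      (fun W i hi j hj => hb (W, ⟨i, hi⟩, ⟨j, hj⟩)) p.1 p.2.1.2 p.2.2.2)
    ([false], ⟨i, by grind⟩, ⟨j, by grind⟩) T ⟨hT, le_rfl⟩
  simpa [entry, word, sub_eq_zero] using h

end

section

/-- A variant of Barbălat's lemma: a bounded function with nonnegative Lipschitz derivative
converges, and its derivative tends to zero. -/
theorem tendsto_of_deriv_nonneg_of_lipschitz {f g : ℝ → ℝ} {M C : ℝ} (hC : 0 ≤ C)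
    (hf : ∀ t ∈ Ici (0 : ℝ), HasDerivWithinAt f (g t) (Ici 0) t)
    (hg : ∀ t ∈ Ici (0 : ℝ), 0 ≤ g t) (hM : ∀ t ∈ Ici (0 : ℝ), f t ≤ M)
    (hlip : ∀ s ∈ Ici (0 : ℝ), ∀ t ∈ Ici (0 : ℝ), |g s - g t| ≤ C * |s - t|) :
    (∃ l, Tendsto f atTop (nhds l)) ∧ Tendsto g atTop (nhds 0) := by
  have hmono : MonotoneOn f (Ici 0) := by
    refine monotoneOn_of_hasDerivWithinAt_nonneg (convex_Ici 0)
      (fun t ht => (hf t ht).continuousWithinAt) (f' := g) (fun t ht => ?_) (fun t ht => ?_)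
    · exact (hf t (interior_subset ht)).mono interior_subset
    · exact hg t (interior_subset ht)
  have hlim : ∃ l, Tendsto f atTop (nhds l) := by
    have hmono' : Monotone fun t => f (max t 0) := fun s t hst =>
      hmono (le_max_right s 0) (le_max_right t 0) (max_le_max_right 0 hst)
    have h := tendsto_atTop_ciSup hmono' ⟨M, by rintro _ ⟨t, rfl⟩; exact hM _ (le_max_right t 0)⟩
    refine ⟨_, h.congr' ?_⟩
    filter_upwards [eventually_ge_atTop 0] with t ht
    rw [max_eq_left ht]
  refine ⟨hlim, ?_⟩
  obtain ⟨l, hl⟩ := hlim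
  rw [Metric.tendsto_atTop']
  intro ε hε
  set h := ε / (2 * (C + 1)) with hh
  have hh0 : 0 < h := by positivity
  have hCh : C * h < ε / 2 := by
    rw [hh, mul_div_assoc', div_lt_div_iff₀ (by positivity) two_pos]
    nlinarith
  have hdiff : Tendsto (fun t => f (t + h) - f t) atTop (nhds 0) := by
    simpa using (hl.comp (tendsto_atTop_add_const_right atTop h tendsto_id)).sub hl
  obtain ⟨t₀, ht₀⟩ := eventually_atTop.1
    ((hdiff.eventually (gt_mem_nhds (show 0 < h * (ε / 2) by positivity))).and
      (eventually_ge_atTop 0))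
  refine ⟨t₀, fun t ht => ?_⟩
  obtain ⟨hlt, ht0⟩ := ht₀ t ht.le
  obtain ⟨s, hs, hsd⟩ := exists_hasDerivAt_eq_slope f g (show t < t + h by linarith)
    (fun s hs => (hf s (ht0.trans hs.1)).continuousWithinAt.mono fun u hu => ht0.trans hu.1)
    (fun s hs => (hf s (ht0.trans hs.1.le)).hasDerivAt (Ici_mem_nhds (ht0.trans_lt hs.1)))
  have hgs : g s < ε / 2 := by
    rw [hsd, add_sub_cancel_left, div_lt_iff₀ hh0]
    linarith
  have hst : |s - t| ≤ h := by
    rw [abs_of_pos (by linarith [hs.1])]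
    linarith [hs.2]
  have hlt' := (abs_le.1 (hlip s (ht0.trans hs.1.le) t ht0)).1
  have := mul_le_mul_of_nonneg_left hst hC
  rw [dist_zero_right, Real.norm_of_nonneg (hg t ht0)]
  linarith

/-- Pointwise convergence of bounded operators may be tested on a set with dense span. -/
theorem tendsto_of_dense_span {E F : Type*} [NormedAddCommGroup E] [NormedSpace ℝ E]
    [NormedAddCommGroup F] [NormedSpace ℝ F] {ι : Type*} {l : Filter ι} {T : ι → E →L[ℝ] F}
    {A : E →L[ℝ] F} {C : ℝ} (hC : ∀ t, ‖T t‖ ≤ C) {s : Set E}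
    (hs : (Submodule.span ℝ s).topologicalClosure = ⊤)
    (h : ∀ x ∈ s, Tendsto (fun t => T t x) l (nhds (A x))) (x : E) :
    Tendsto (fun t => T t x) l (nhds (A x)) := by
  let p : Submodule ℝ E :=
    { carrier := {x | Tendsto (fun t => T t x) l (nhds (A x))}
      add_mem' := fun {x y} hx hy => by
        simpa using Tendsto.add (f := fun t => T t x) (g := fun t => T t y) hx hy
      zero_mem' := by simpa using tendsto_const_nhds
      smul_mem' := fun c x hx => by
        simpa using Tendsto.const_smul (f := fun t => T t x) hx c }
  have hp : IsClosed (p : Set E) := by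
    refine Equicontinuous.isClosed_setOfPred_tendsto (F := fun t x => T t x) ?_ A.continuous
    refine (LipschitzWith.uniformEquicontinuous _ C.toNNReal fun t => ?_).equicontinuous
    exact (T t).lipschitz.weaken (by
      rw [← NNReal.coe_le_coe, coe_nnnorm]
      exact (hC t).trans (Real.le_coe_toNNReal C))
  have hle := Submodule.topologicalClosure_minimal _ (Submodule.span_le.2 h : _ ≤ p) hp
  rw [hs] at hle
  exact hle (Submodule.mem_top (x := x))

variable {𝓗 : Type*} [NormedAddCommGroup 𝓗]

section

variable [InnerProductSpace ℝ 𝓗]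

/-- Bounded families of columns converge weakly as soon as each column converges. -/
theorem tendsto_inner_of_tendsto_columns {ι : Type*} {l : Filter ι} {γ : ι → Columns 𝓗}
    {x : Columns 𝓗} {C : ℝ} (hC : ∀ t, ‖γ t‖ ≤ C) (h : ∀ i, Tendsto (fun t => γ t i) l (nhds (x i)))
    (b : Columns 𝓗) : Tendsto (fun t => ⟪b, γ t⟫) l (nhds ⟪b, x⟫) := by
  have hdense : (Submodule.span ℝ {y : Columns 𝓗 | ∃ i v, lp.single 2 i v = y}).topologicalClosure
      = ⊤ := by
    rw [Submodule.eq_top_iff']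
    intro y
    refine mem_closure_of_tendsto (lp.hasSum_single (by norm_num) y) (Eventually.of_forall ?_)
    exact fun s => Submodule.sum_mem _ fun i _ => Submodule.subset_span ⟨i, y i, rfl⟩
  have h' := tendsto_of_dense_span (l := l) (T := fun t => innerSL ℝ (γ t)) (A := innerSL ℝ x)
    (C := C) (fun t => by simpa using hC t) hdense (by
      rintro _ ⟨i, v, rfl⟩
      simp only [innerSL_apply_apply, lp.inner_single_right]
      exact (h i).inner tendsto_const_nhds) b
  simpa only [innerSL_apply_apply, real_inner_comm b] using h'

variable (e : HilbertBasis ℕ ℝ 𝓗)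

theorem norm_sub_proj_sq (n : ℕ) (v : 𝓗) :
    ‖v - proj e n v‖ ^ 2 = ‖v‖ ^ 2 - ∑ j ∈ Finset.range n, ⟪v, e j⟫ ^ 2 := by
  have h1 : ⟪v, proj e n v⟫ = ∑ j ∈ Finset.range n, ⟪v, e j⟫ ^ 2 := by
    rw [proj_apply, inner_sum]
    simp [inner_smul_right, sq, real_inner_comm]
  have h2 : ‖proj e n v‖ ^ 2 = ∑ j ∈ Finset.range n, ⟪v, e j⟫ ^ 2 := by
    rw [proj_apply, ← real_inner_self_eq_norm_sq, e.orthonormal.inner_sum]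
    simp [sq, real_inner_comm]
  rw [norm_sub_sq_real, h1, h2]
  ring

theorem inner_self_gen (x : Columns 𝓗) (i : ℕ) :
    ⟪x i, gen e x i⟫ = ‖x i‖ ^ 2 - ∑ j ∈ Finset.range i, ⟪x i, e j⟫ ^ 2 -
      ∑ j ∈ Finset.range (i + 1), ⟪x i, e j⟫ ^ 2 := by
  simp only [gen, mapColumns_apply, sub_apply, id_apply, inner_sub_right, proj_apply, inner_sum,
    inner_smul_right, real_inner_self_eq_norm_sq]
  simp [sq, real_inner_comm]

theorem sum_triangle {k : ℕ → ℕ → ℝ} (hk : ∀ i j, k i j = k j i) (n : ℕ) :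
    ∑ i ∈ Finset.range n, (∑ j ∈ Finset.range i, k i j + ∑ j ∈ Finset.range (i + 1), k i j) =
      ∑ i ∈ Finset.range n, ∑ j ∈ Finset.range n, k i j := by
  induction n with
  | zero => simp
  | succ n ih =>
    have h : ∑ i ∈ Finset.range n, k i n = ∑ i ∈ Finset.range n, k n i :=
      Finset.sum_congr rfl fun i _ => hk i n
    rw [Finset.sum_range_succ, ih, Finset.sum_range_succ _ n, Finset.sum_range_succ _ n]
    simp only [Finset.sum_range_succ _ n, Finset.sum_add_distrib, h]
    ring

theorem sum_inner_self_gen {x : Columns 𝓗} (hx : x ∈ symm e) (n : ℕ) :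
    ∑ i ∈ Finset.range n, ⟪x i, gen e x i⟫ =
      ∑ i ∈ Finset.range n, ‖x i - proj e n (x i)‖ ^ 2 := by
  have h := sum_triangle (k := fun i j => ⟪x i, e j⟫ ^ 2) (fun i j => by rw [hx i j]) n
  simp only [inner_self_gen, norm_sub_proj_sq, Finset.sum_sub_distrib, ← h,
    Finset.sum_add_distrib]
  ring

/-- The squared Hilbert–Schmidt norm of the off-diagonal block of the first `n` columns. -/
noncomputable def tailNormSq (n : ℕ) (x : Columns 𝓗) : ℝ :=
  ∑ i ∈ Finset.range n, ‖x i - proj e n (x i)‖ ^ 2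

theorem norm_sub_proj_le (n : ℕ) (v : 𝓗) : ‖v - proj e n v‖ ≤ 2 * ‖v‖ := by
  have := norm_sub_le v (proj e n v)
  have := norm_proj_le e n v
  linarith

theorem abs_tailNormSq_sub_le (n : ℕ) (x y : Columns 𝓗) :
    |tailNormSq e n x - tailNormSq e n y| ≤ n * (4 * (‖x‖ + ‖y‖) * ‖x - y‖) := by
  rw [tailNormSq, tailNormSq, ← Finset.sum_sub_distrib]
  refine (Finset.abs_sum_le_sum_abs _ _).trans ?_
  refine (Finset.sum_le_card_nsmul _ _ _ fun i _ => ?_).trans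
    (by rw [Finset.card_range, nsmul_eq_mul])
  have hx := (norm_sub_proj_le e n (x i)).trans
    (mul_le_mul_of_nonneg_left (lp.norm_apply_le_norm two_ne_zero x i) zero_le_two)
  have hy := (norm_sub_proj_le e n (y i)).trans
    (mul_le_mul_of_nonneg_left (lp.norm_apply_le_norm two_ne_zero y i) zero_le_two)
  have hxy := (norm_sub_proj_le e n ((x - y) i)).trans
    (mul_le_mul_of_nonneg_left (lp.norm_apply_le_norm two_ne_zero (x - y) i) zero_le_two)
  have hsub := abs_norm_sub_norm_le (x i - proj e n (x i)) (y i - proj e n (y i))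
  rw [lp.coeFn_sub, Pi.sub_apply, map_sub, sub_sub_sub_comm] at hxy
  rw [sq_sub_sq, abs_mul, abs_of_nonneg (by positivity)]
  calc _ ≤ (2 * ‖x‖ + 2 * ‖y‖) * (2 * ‖x - y‖) := by
        gcongr
        exact hsub.trans hxy
    _ = _ := by ring

end

variable [InnerProductSpace ℝ 𝓗] [CompleteSpace 𝓗] (e : HilbertBasis ℕ ℝ 𝓗)

theorem inner_field_basis {x : Columns 𝓗} (hx : x ∈ symm e) (i : ℕ) :
    ⟪field e x i, e i⟫ = 2 * ⟪x i, gen e x i⟫ := by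
  have h1 : ⟪ofColumns e x (gen e x i), e i⟫ = ⟪x i, gen e x i⟫ := by
    rw [← adjoint_inner_right, adjoint_ofColumns e hx, ofColumns_basis, real_inner_comm]
  have h2 : ⟪ofColumns e (gen e x) (x i), e i⟫ = -⟪x i, gen e x i⟫ := by
    rw [← adjoint_inner_right, adjoint_ofColumns_gen e hx, neg_apply, ofColumns_basis,
      inner_neg_right]
  rw [field, lp.coeFn_sub, Pi.sub_apply, inner_sub_left, leftMul_apply, leftMul_apply, h1, h2]
  ring

variable {e}

/-- The columns of a Toda flow converge to multiples of the basis vectors. -/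
theorem exists_tendsto_columns {γ : ℝ → Columns 𝓗} {R : ℝ}
    (hγ : ∀ t ∈ Ici (0 : ℝ), HasDerivWithinAt γ (field e (γ t)) (Ici 0) t)
    (hsymm : ∀ t, γ t ∈ symm e) (hR : ∀ t, ‖γ t‖ ≤ R) :
    ∃ α : ℕ → ℝ, ∀ i, Tendsto (fun t => γ t i) atTop (nhds (α i • e i)) := by
  have hR0 : 0 ≤ R := (norm_nonneg _).trans (hR 0)
  have hcol (i : ℕ) : ∀ t ∈ Ici (0 : ℝ),
      HasDerivWithinAt (fun t => γ t i) (field e (γ t) i) (Ici 0) t := fun t ht =>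
    (lp.evalCLM ℝ (fun _ : ℕ => 𝓗) 2 i).hasFDerivAt.comp_hasDerivWithinAt t (hγ t ht)
  have hlip : ∀ s ∈ Ici (0 : ℝ), ∀ t ∈ Ici (0 : ℝ), ‖γ s - γ t‖ ≤ 6 * R ^ 2 * |s - t| :=
    fun s hs t ht => (convex_Ici 0).norm_image_sub_le_of_norm_hasDerivWithin_le hγ
      (fun u _ => (norm_field_le e _).trans (by gcongr; exact hR u)) ht hs
  have hsum (n : ℕ) := tendsto_of_deriv_nonneg_of_lipschitz
    (f := fun t => ∑ i ∈ Finset.range n, ⟪γ t i, e i⟫) (g := fun t => 2 * tailNormSq e n (γ t))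
    (M := n * R) (C := 2 * (n * (4 * (R + R) * (6 * R ^ 2)))) (by positivity)
    (fun t ht => by
      have h := HasDerivWithinAt.fun_sum (u := Finset.range n) fun i _ =>
        (hcol i t ht).inner ℝ (hasDerivWithinAt_const t (Ici 0) (e i))
      refine h.congr_deriv ?_
      simp only [inner_zero_right, zero_add, inner_field_basis e (hsymm t), ← Finset.mul_sum,
        sum_inner_self_gen e (hsymm t), tailNormSq])
    (fun t _ => by unfold tailNormSq; positivity)
    (fun t _ => by
      refine (Finset.sum_le_card_nsmul _ _ R fun i _ => ?_).trans (by simp)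
      refine (real_inner_le_norm _ _).trans ?_
      rw [e.orthonormal.1, mul_one]
      exact (lp.norm_apply_le_norm two_ne_zero _ i).trans (hR t))
    (fun s hs t ht => by
      rw [← mul_sub, abs_mul, abs_two, mul_assoc, mul_assoc]
      refine mul_le_mul_of_nonneg_left ((abs_tailNormSq_sub_le e n _ _).trans ?_) zero_le_two
      refine mul_le_mul_of_nonneg_left ?_ n.cast_nonneg
      calc _ ≤ 4 * (R + R) * (6 * R ^ 2 * |s - t|) := by
            gcongr
            exacts [hR s, hR t, hlip s hs t ht]
        _ = _ := by ring)
  have htail {i n : ℕ} (hi : i < n) :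
      Tendsto (fun t => γ t i - proj e n (γ t i)) atTop (nhds 0) := by
    have h0 : Tendsto (fun t => tailNormSq e n (γ t)) atTop (nhds 0) := by
      simpa using (hsum n).2.div_const 2
    have h1 : Tendsto (fun t => ‖γ t i - proj e n (γ t i)‖ ^ 2) atTop (nhds 0) :=
      squeeze_zero (fun _ => by positivity) (fun t => Finset.single_le_sum
        (f := fun i => ‖γ t i - proj e n (γ t i)‖ ^ 2) (fun _ _ => by positivity)
        (Finset.mem_range.2 hi)) h0
    rw [tendsto_zero_iff_norm_tendsto_zero]
    simpa using h1.sqrt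
  have hdiag (i : ℕ) : ∃ a, Tendsto (fun t => ⟪γ t i, e i⟫) atTop (nhds a) := by
    obtain ⟨a, ha⟩ := (hsum i).1
    obtain ⟨b, hb⟩ := (hsum (i + 1)).1
    exact ⟨b - a, (hb.sub ha).congr fun t => by simp [Finset.sum_range_succ]⟩
  have hoff {i j : ℕ} (hij : j < i) : Tendsto (fun t => ⟪e j, γ t i⟫) atTop (nhds 0) := by
    have h := (htail (Nat.lt_succ_self j)).inner (𝕜 := ℝ) (tendsto_const_nhds (x := e i))
    rw [inner_zero_left] at h
    refine h.congr fun t => ?_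
    rw [inner_sub_left, inner_proj_basis, if_neg (by omega), sub_zero, hsymm t j i, real_inner_comm]
  choose α hα using hdiag
  refine ⟨α, fun i => ?_⟩
  have hproj : Tendsto (fun t => proj e (i + 1) (γ t i)) atTop (nhds (α i • e i)) := by
    have h0 : Tendsto (fun t => ∑ j ∈ Finset.range i, ⟪e j, γ t i⟫ • e j) atTop
        (nhds (∑ j ∈ Finset.range i, (0 : ℝ) • e j)) :=
      tendsto_finsetSum _ fun j hj => (hoff (Finset.mem_range.1 hj)).smul_const _
    have h1 := h0.add ((hα i).smul_const (e i))
    simpa [proj_apply, Finset.sum_range_succ, real_inner_comm] using h1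
  simpa using (htail (Nat.lt_succ_self i)).add hproj

end

end Toda

/-- Toda flow in infinite dimension. For every symmetric Hilbert–Schmidt
`H₀` the Cauchy problem `H' = [H, H⁻ − (H⁻)*]`, `H(0) = H₀`, where `H⁻` is the
lower-triangular part of `H` in the basis `(e_n)` (here encoded by its matrix coefficients:
`⟪H⁻ e_i, e_j⟫ = ⟪H e_i, e_j⟫` if `i ≤ j` and `0` otherwise), admits a unique global
solution which converges weakly in `S₂(𝓗)` (and strongly as an operator) to a diagonal
Hilbert–Schmidt operator. -/
theorem stmt18
    {𝓗 : Type*} [NormedAddCommGroup 𝓗] [InnerProductSpace ℝ 𝓗] [CompleteSpace 𝓗]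
    (e : HilbertBasis ℕ ℝ 𝓗)
    (H₀ : 𝓗 →L[ℝ] 𝓗)
    (hH₀sym : ∀ x y, ⟪H₀ x, y⟫ = ⟪x, H₀ y⟫)
    (hH₀HS : Summable fun n => ‖H₀ (e n)‖ ^ 2) :
    ∃ H Hm : ℝ → 𝓗 →L[ℝ] 𝓗,
      -- `Hm t` is the lower-triangular part `H(t)⁻`
      (∀ t : ℝ, ∀ i j : ℕ,
        ⟪Hm t (e i), e j⟫ = if i ≤ j then ⟪H t (e i), e j⟫ else 0) ∧
      -- `H` solves the Toda flow `H' = [H, H⁻ − (H⁻)*]` on `[0,∞)`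
      (H 0 = H₀ ∧
        ∀ t ∈ Ici (0 : ℝ),
          HasDerivWithinAt H
            (H t * (Hm t - adjoint (Hm t)) - (Hm t - adjoint (Hm t)) * H t)
            (Ici 0) t) ∧
      -- `H(t)` is symmetric Hilbert–Schmidt for all `t ≥ 0`
      (∀ t ∈ Ici (0 : ℝ),
        (∀ x y, ⟪H t x, y⟫ = ⟪x, H t y⟫) ∧ Summable fun n => ‖H t (e n)‖ ^ 2) ∧
      -- uniqueness
      (∀ K Km : ℝ → 𝓗 →L[ℝ] 𝓗,
        ((∀ t : ℝ, ∀ i j : ℕ,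
          ⟪Km t (e i), e j⟫ = if i ≤ j then ⟪K t (e i), e j⟫ else 0) ∧
         K 0 = H₀ ∧
         ∀ t ∈ Ici (0 : ℝ),
           HasDerivWithinAt K
             (K t * (Km t - adjoint (Km t)) - (Km t - adjoint (Km t)) * K t)
             (Ici 0) t) →
        ∀ t ∈ Ici (0 : ℝ), K t = H t) ∧
      -- convergence to a diagonal Hilbert–Schmidt operator
      (∃ Hinf : 𝓗 →L[ℝ] 𝓗, ∃ α : ℕ → ℝ,
        (∀ n, Hinf (e n) = α n • e n) ∧
        (Summable fun n => ‖Hinf (e n)‖ ^ 2) ∧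
        (∀ x : 𝓗, Tendsto (fun t => H t x) atTop (nhds (Hinf x))) ∧
        (∀ B : 𝓗 →L[ℝ] 𝓗, (∀ x y, ⟪B x, y⟫ = ⟪x, B y⟫) →
          (Summable fun n => ‖B (e n)‖ ^ 2) →
          Tendsto (fun t => ∑' n, ⟪B (e n), H t (e n)⟫) atTop
            (nhds (∑' n, ⟪B (e n), Hinf (e n)⟫)))) := by
  obtain ⟨x₀, hx₀⟩ : ∃ x₀ : Toda.Columns 𝓗, ∀ i, x₀ i = H₀ (e i) :=
    ⟨⟨fun n => H₀ (e n), Toda.memℓp_two_iff.2 hH₀HS⟩, fun _ => rfl⟩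
  obtain ⟨γ, h0, hγ, hsymm, hnorm⟩ := Toda.exists_columns_flow e (x₀ := x₀) fun i j => by
    rw [hx₀, hx₀, hH₀sym, real_inner_comm]
  obtain ⟨α, hα⟩ := Toda.exists_tendsto_columns hγ hsymm fun t => (hnorm t).le
  have hlower (t : ℝ) : Toda.IsLower e (Toda.ofColumns e (Toda.lower e (γ t)))
      (Toda.ofColumns e (γ t)) := fun i j => by
    rw [Toda.ofColumns_basis, Toda.ofColumns_basis, Toda.inner_lower]
  have hinit : Toda.ofColumns e (γ 0) = H₀ := Toda.ext_basis e fun i => by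
    rw [Toda.ofColumns_basis, h0, hx₀]
  have hflow : ∀ t ∈ Ici (0 : ℝ), HasDerivWithinAt (fun t => Toda.ofColumns e (γ t))
      (Toda.ofColumns e (γ t) * (Toda.ofColumns e (Toda.lower e (γ t)) -
        adjoint (Toda.ofColumns e (Toda.lower e (γ t)))) -
      (Toda.ofColumns e (Toda.lower e (γ t)) -
        adjoint (Toda.ofColumns e (Toda.lower e (γ t)))) * Toda.ofColumns e (γ t))
      (Ici 0) t := fun t ht => by
    rw [← Toda.ofColumns_gen e (hsymm t), ← Toda.ofColumns_field]
    exact (Toda.ofColumns e).hasFDerivAt.comp_hasDerivWithinAt t (hγ t ht)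
  obtain ⟨y, hy⟩ : ∃ y : Toda.Columns 𝓗, ∀ i, y i = α i • e i :=
    ⟨⟨fun i => α i • e i, lp.memℓp_of_tendsto (F := γ) (l := atTop)
      (isBounded_iff_forall_norm_le.2 ⟨‖x₀‖, by rintro _ ⟨t, rfl⟩; exact (hnorm t).le⟩)
      (tendsto_pi_nhds.2 hα)⟩, fun _ => rfl⟩
  refine ⟨fun t => Toda.ofColumns e (γ t), fun t => Toda.ofColumns e (Toda.lower e (γ t)), hlower,
    ⟨hinit, hflow⟩, fun t _ => ⟨fun x z => ?_, Toda.summable_norm_sq_ofColumns e _⟩, ?_,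
    Toda.ofColumns e y, α, fun n => by rw [Toda.ofColumns_basis, hy],
    Toda.summable_norm_sq_ofColumns e y, ?_, ?_⟩
  · rw [← adjoint_inner_right, Toda.adjoint_ofColumns e (hsymm t)]
  · rintro K Km ⟨hKm, hK0, hK⟩ t ht
    exact Toda.toda_unique hKm hlower hK hflow (hK0.trans hinit.symm) ht
  · refine Toda.tendsto_of_dense_span (C := ‖x₀‖)
      (fun t => (Toda.norm_ofColumns_le e _).trans (hnorm t).le) e.dense_span ?_
    rintro _ ⟨i, rfl⟩
    simpa only [Toda.ofColumns_basis, hy] using hα i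
  · intro B _ hB
    simpa only [lp.inner_eq_tsum, Toda.ofColumns_basis] using
      Toda.tendsto_inner_of_tendsto_columns (fun t => (hnorm t).le)
        (fun i => by simpa only [hy] using hα i) ⟨fun n => B (e n), Toda.memℓp_two_iff.2 hB⟩
end

section
/- Wegner flow: for every H₀ ∈ S₂(H) the Cauchy problem H' = [H, [H, diag(H)]], H(0) = H₀, where diag(H) = Σ_n ⟨He_n, e_n⟩ e_n*(·) e_n is the diagonal part of H in the basis (e_n), admits a unique global solution H ∈ C¹([0,∞), S₂(H)) with ‖H(t)‖_HS = ‖H₀‖_HS for all t ≥ 0, and its diagonal coefficients satisfy h_{i,i}'(t) = 2 Σ_{j=0}^∞ (h_{i,i}(t) − h_{j,j}(t)) |h_{i,j}(t)|² for every i ∈ ℕ and t ≥ 0. -/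
open MeasureTheory Filter Set ContinuousLinearMap
open scoped RealInnerProductSpace

section ODE

variable {E : Type*} [NormedAddCommGroup E]

/-- A bounded, globally Lipschitz autonomous vector field on a Banach space has a global
integral curve through every point. -/
theorem exists_hasDerivAt_of_lipschitzWith_of_bounded [NormedSpace ℝ E] [CompleteSpace E]
    {f : E → E} {K L : NNReal} (hK : LipschitzWith K f) (hL : ∀ x, ‖f x‖ ≤ L) (x₀ : E) :
    ∃ α : ℝ → E, α 0 = x₀ ∧ ∀ t, HasDerivAt α (f (α t)) t := by
  have hloc (n : ℕ) : ∃ α : ℝ → E, α 0 = x₀ ∧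
      ∀ t ∈ Ioo (-(n + 1 : ℝ)) (n + 1), HasDerivAt α (f (α t)) t := by
    have h0 : (0 : ℝ) ∈ Icc (-(n + 1 : ℝ)) (n + 1) :=
      ⟨by linarith [n.cast_nonneg (α := ℝ)], by positivity⟩
    have hP : IsPicardLindelof (fun _ ↦ f) (⟨0, h0⟩ : Icc (-(n + 1 : ℝ)) (n + 1)) x₀
        (L * (n + 1)) 0 L K :=
      IsPicardLindelof.of_time_independent (fun x _ ↦ hL x) hK.lipschitzOnWith (by simp)
    obtain ⟨α, h1, h2⟩ := hP.exists_eq_forall_mem_Icc_hasDerivWithinAt₀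
    exact ⟨α, h1, fun t ht ↦ (h2 t (Ioo_subset_Icc_self ht)).hasDerivAt (Icc_mem_nhds ht.1 ht.2)⟩
  choose α h0 hα using hloc
  have hcons {n m : ℕ} (hnm : n ≤ m) {t : ℝ} (ht : |t| < n + 1) : α n t = α m t := by
    have hn : (0 : ℝ) < n + 1 := by positivity
    have hnm' : (n : ℝ) ≤ m := by exact_mod_cast hnm
    refine ODE_solution_unique_of_mem_Ioo (v := fun _ ↦ f) (s := fun _ ↦ univ) (K := K)
      (t₀ := 0) (fun _ _ ↦ hK.lipschitzOnWith) ⟨neg_lt_zero.2 hn, hn⟩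
      (fun s hs ↦ ⟨hα n s hs, trivial⟩)
      (fun s hs ↦ ⟨hα m s ⟨by linarith [hs.1], by linarith [hs.2]⟩, trivial⟩)
      ((h0 n).trans (h0 m).symm) (abs_lt.1 ht)
  refine ⟨fun t ↦ α ⌈|t|⌉₊ t, by simpa using h0 _, fun t ↦ ?_⟩
  have hloc : ∀ s, |s| < |t| + 1 → α ⌈|s|⌉₊ s = α (⌈|t|⌉₊ + 1) s := fun s hs ↦ by
    refine hcons (Nat.ceil_le.2 ?_) ((Nat.le_ceil _).trans_lt (lt_add_one _))
    push_cast
    linarith [Nat.le_ceil |t|]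
  have hmem : t ∈ Ioo (-((⌈|t|⌉₊ + 1 : ℕ) + 1 : ℝ)) ((⌈|t|⌉₊ + 1 : ℕ) + 1) := by
    rw [mem_Ioo, ← abs_lt]
    push_cast
    linarith [Nat.le_ceil |t|]
  have hd := hα _ t hmem
  simp only [hloc t (lt_add_one _)]
  refine hd.congr_of_eventuallyEq ?_
  filter_upwards [continuous_abs.continuousAt.eventually (gt_mem_nhds (lt_add_one |t|))] with s hs
  exact hloc s hs

/-- A map is Lipschitz on every closed ball centred at the origin. -/
def LipschitzOnBalls {F : Type*} [NormedAddCommGroup F] (f : E → F) : Prop :=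
  ∀ R : ℝ, ∃ K : NNReal, LipschitzOnWith K f (Metric.closedBall 0 R)

theorem LipschitzOnBalls.exists_bound {F : Type*} [NormedAddCommGroup F] {f : E → F}
    (hf : LipschitzOnBalls f) (R : ℝ) :
    ∃ M : NNReal, ∀ x ∈ Metric.closedBall (0 : E) R, ‖f x‖ ≤ M := by
  obtain ⟨K, hK⟩ := hf R
  refine ⟨(‖f 0‖ + K * R).toNNReal, fun x hx ↦ le_trans ?_ (Real.le_coe_toNNReal _)⟩
  have h0 : (0 : E) ∈ Metric.closedBall (0 : E) R :=
    Metric.mem_closedBall_self (Metric.nonempty_closedBall.1 ⟨x, hx⟩)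
  have h := hK.dist_le_mul x hx 0 h0
  rw [dist_eq_norm, dist_zero_right] at h
  rw [mem_closedBall_zero_iff] at hx
  calc ‖f x‖ ≤ ‖f 0‖ + ‖f x - f 0‖ := norm_le_norm_add_norm_sub' _ _
    _ ≤ ‖f 0‖ + K * R := by grw [h, hx]

theorem LipschitzWith.lipschitzOnBalls {F : Type*} [NormedAddCommGroup F] {f : E → F}
    {K : NNReal} (hf : LipschitzWith K f) : LipschitzOnBalls f :=
  fun _ ↦ ⟨K, hf.lipschitzOnWith⟩

theorem LipschitzWith.comp_lipschitzOnBalls {F G : Type*} [NormedAddCommGroup F]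
    [NormedAddCommGroup G] {f : E → F} {g : F → G}
    {K : NNReal} (hg : LipschitzWith K g) (hf : LipschitzOnBalls f) :
    LipschitzOnBalls (fun x ↦ g (f x)) := fun R ↦
  let ⟨C, hC⟩ := hf R
  ⟨K * C, hg.comp_lipschitzOnWith hC⟩

theorem LipschitzOnBalls.sub {F : Type*} [NormedAddCommGroup F] {f g : E → F}
    (hf : LipschitzOnBalls f) (hg : LipschitzOnBalls g) :
    LipschitzOnBalls (fun x ↦ f x - g x) := fun R ↦
  let ⟨C, hC⟩ := hf R
  let ⟨C', hC'⟩ := hg R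
  ⟨C + C', hC.sub hC'⟩

theorem LipschitzOnBalls.mul {A : Type*} [NormedRing A] {f g : E → A}
    (hf : LipschitzOnBalls f) (hg : LipschitzOnBalls g) :
    LipschitzOnBalls (fun x ↦ f x * g x) := fun R ↦ by
  obtain ⟨C, hC⟩ := hf R
  obtain ⟨C', hC'⟩ := hg R
  obtain ⟨M, hM⟩ := hf.exists_bound R
  obtain ⟨M', hM'⟩ := hg.exists_bound R
  refine ⟨M * C' + C * M', LipschitzOnWith.of_dist_le_mul fun x hx y hy ↦ ?_⟩
  have h1 := hC.dist_le_mul x hx y hy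
  have h2 := hC'.dist_le_mul x hx y hy
  rw [dist_eq_norm] at h1 h2 ⊢
  calc ‖f x * g x - f y * g y‖ = ‖f x * (g x - g y) + (f x - f y) * g y‖ := by
        congr 1; noncomm_ring
    _ ≤ ‖f x‖ * ‖g x - g y‖ + ‖f x - f y‖ * ‖g y‖ :=
        (norm_add_le _ _).trans (add_le_add (norm_mul_le _ _) (norm_mul_le _ _))
    _ ≤ M * (C' * dist x y) + C * dist x y * M' := by
        gcongr
        exacts [hM x hx, hM' y hy]
    _ = (M * C' + C * M' : NNReal) * dist x y := by push_cast; ring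

/-- A Lipschitz cutoff, equal to `1` on the unit ball and to `0` outside the ball of radius `2`. -/
noncomputable def normCutoff (x : E) : ℝ := max 0 (min 1 (2 - ‖x‖))

theorem normCutoff_of_norm_le_one {x : E} (hx : ‖x‖ ≤ 1) : normCutoff x = 1 := by
  rw [normCutoff, min_eq_left (by linarith), max_eq_right zero_le_one]

theorem normCutoff_of_two_le_norm {x : E} (hx : 2 ≤ ‖x‖) : normCutoff x = 0 :=
  max_eq_left ((min_le_right _ _).trans (by linarith))

theorem abs_normCutoff_le_one (x : E) : |normCutoff x| ≤ 1 := by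
  rw [normCutoff, abs_of_nonneg (le_max_left _ _)]
  exact max_le zero_le_one (min_le_left _ _)

theorem abs_normCutoff_sub_le (x y : E) : |normCutoff x - normCutoff y| ≤ ‖x - y‖ := by
  have h := abs_le.1 (abs_norm_sub_norm_le x y)
  have h0 := norm_nonneg (x - y)
  rw [abs_le]
  unfold normCutoff
  grind

theorem LipschitzOnBalls.normCutoff_smul {F : Type*} [NormedAddCommGroup F] [NormedSpace ℝ F]
    {f : E → F} (hf : LipschitzOnBalls f) :
    ∃ K L : NNReal, LipschitzWith K (fun x ↦ normCutoff x • f x) ∧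
      ∀ x, ‖normCutoff x • f x‖ ≤ L := by
  obtain ⟨K, hK⟩ := hf 2
  obtain ⟨M, hM⟩ := hf.exists_bound 2
  simp only [mem_closedBall_zero_iff] at hM
  have hout {x y : E} (hx : ‖x‖ ≤ 2) (hy : 2 ≤ ‖y‖) :
      ‖normCutoff x • f x - normCutoff y • f y‖ ≤ (K + M : NNReal) * ‖x - y‖ := by
    have h := abs_normCutoff_sub_le x y
    rw [normCutoff_of_two_le_norm hy, sub_zero] at h
    rw [normCutoff_of_two_le_norm hy, zero_smul, sub_zero, norm_smul, Real.norm_eq_abs]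
    calc |normCutoff x| * ‖f x‖ ≤ ‖x - y‖ * M := by gcongr; exact hM x hx
      _ ≤ (K + M : NNReal) * ‖x - y‖ := by
        push_cast
        nlinarith [mul_nonneg K.coe_nonneg (norm_nonneg (x - y))]
  refine ⟨K + M, M, LipschitzWith.of_dist_le_mul fun x y ↦ ?_, fun x ↦ ?_⟩
  · rw [dist_eq_norm, dist_eq_norm]
    rcases le_total ‖x‖ 2 with hx | hx <;> rcases le_total ‖y‖ 2 with hy | hy
    · have h1 := hK.dist_le_mul x (by simpa using hx) y (by simpa using hy)
      rw [dist_eq_norm, dist_eq_norm] at h1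
      calc ‖normCutoff x • f x - normCutoff y • f y‖
          = ‖normCutoff x • (f x - f y) + (normCutoff x - normCutoff y) • f y‖ := by
            congr 1; module
        _ ≤ |normCutoff x| * ‖f x - f y‖ + |normCutoff x - normCutoff y| * ‖f y‖ := by
            refine (norm_add_le _ _).trans_eq ?_
            rw [norm_smul, norm_smul, Real.norm_eq_abs, Real.norm_eq_abs]
        _ ≤ 1 * (K * ‖x - y‖) + ‖x - y‖ * M := by
            gcongr
            exacts [abs_normCutoff_le_one x, abs_normCutoff_sub_le x y, hM y hy]
        _ = (K + M : NNReal) * ‖x - y‖ := by push_cast; ring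
    · exact hout hx hy
    · rw [norm_sub_rev, norm_sub_rev x]
      exact hout hy hx
    · rw [normCutoff_of_two_le_norm hx, normCutoff_of_two_le_norm hy]
      simp only [zero_smul, sub_zero, norm_zero]
      positivity
  · rcases le_total ‖x‖ 2 with hx | hx
    · rw [norm_smul, Real.norm_eq_abs]
      calc |normCutoff x| * ‖f x‖ ≤ 1 * M := by
            gcongr
            exacts [abs_normCutoff_le_one x, hM x hx]
        _ = M := one_mul _
    · simp [normCutoff_of_two_le_norm hx]

/-- Two forward solutions of an autonomous equation whose vector field is Lipschitz on balls
coincide as soon as they have the same initial value. -/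
theorem LipschitzOnBalls.eq_of_hasDerivWithinAt [NormedSpace ℝ E] {v : E → E}
    (hv : LipschitzOnBalls v) {f g : ℝ → E} (hf : ∀ t ∈ Ici (0 : ℝ), HasDerivWithinAt f (v (f t)) (Ici 0) t)
    (hg : ∀ t ∈ Ici (0 : ℝ), HasDerivWithinAt g (v (g t)) (Ici 0) t) (h0 : f 0 = g 0) :
    ∀ t ∈ Ici (0 : ℝ), f t = g t := by
  intro t ht
  have hcont {u : ℝ → E} (hu : ∀ t ∈ Ici (0 : ℝ), HasDerivWithinAt u (v (u t)) (Ici 0) t) :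
      ContinuousOn u (Icc 0 t) := fun s hs ↦
    ((hu s hs.1).continuousWithinAt).mono Icc_subset_Ici_self
  obtain ⟨Rf, hRf⟩ := isCompact_Icc.exists_bound_of_continuousOn (hcont hf)
  obtain ⟨Rg, hRg⟩ := isCompact_Icc.exists_bound_of_continuousOn (hcont hg)
  obtain ⟨K, hK⟩ := hv (max Rf Rg)
  refine ODE_solution_unique_of_mem_Icc_right (v := fun _ ↦ v)
    (s := fun _ ↦ Metric.closedBall 0 (max Rf Rg)) (fun _ _ ↦ hK) (hcont hf)
    (fun s hs ↦ (hf s hs.1).mono (Ici_subset_Ici.2 hs.1)) (fun s hs ↦ ?_) (hcont hg)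
    (fun s hs ↦ (hg s hs.1).mono (Ici_subset_Ici.2 hs.1)) (fun s hs ↦ ?_) h0 ⟨ht, le_rfl⟩
  · exact mem_closedBall_zero_iff.2 ((hRf s (Ico_subset_Icc_self hs)).trans (le_max_left _ _))
  · exact mem_closedBall_zero_iff.2 ((hRg s (Ico_subset_Icc_self hs)).trans (le_max_right _ _))

end ODE

section Diagonal

variable {𝓗 : Type*} [NormedAddCommGroup 𝓗] [InnerProductSpace ℝ 𝓗]

theorem HilbertBasis.continuousLinearMap_ext {F : Type*} [NormedAddCommGroup F]
    [NormedSpace ℝ F] (e : HilbertBasis ℕ ℝ 𝓗) {S T : 𝓗 →L[ℝ] F}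
    (h : ∀ n, S (e n) = T (e n)) : S = T :=
  ContinuousLinearMap.ext_on
    ((Submodule.dense_iff_topologicalClosure_eq_top).2 e.dense_span)
    (by rintro _ ⟨n, rfl⟩; exact h n)

theorem HilbertBasis.norm_eq_one (e : HilbertBasis ℕ ℝ 𝓗) (n : ℕ) : ‖e n‖ = 1 :=
  e.orthonormal.1 n

theorem HilbertBasis.abs_inner_apply_self_le (e : HilbertBasis ℕ ℝ 𝓗) (T : 𝓗 →L[ℝ] 𝓗) (n : ℕ) :
    |⟪T (e n), e n⟫| ≤ ‖T‖ := by
  have h1 := abs_real_inner_le_norm (T (e n)) (e n)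
  have h2 := T.le_opNorm (e n)
  rw [e.norm_eq_one, mul_one] at h1 h2
  exact h1.trans h2

/-- The diagonal part of a bounded operator with respect to a Hilbert basis. -/
noncomputable def HilbertBasis.diagPart (e : HilbertBasis ℕ ℝ 𝓗) (T : 𝓗 →L[ℝ] 𝓗) : 𝓗 →L[ℝ] 𝓗 :=
  e.repr.symm.toContinuousLinearEquiv.toContinuousLinearMap ∘L
    (lp.mapCLM 2 (fun n ↦ ⟪T (e n), e n⟫ • ContinuousLinearMap.id ℝ ℝ) (norm_nonneg T)
      (fun n ↦ by
        rw [norm_smul, ContinuousLinearMap.norm_id, mul_one]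
        exact e.abs_inner_apply_self_le T n)) ∘L
    e.repr.toContinuousLinearEquiv.toContinuousLinearMap

theorem HilbertBasis.norm_diagPart_le (e : HilbertBasis ℕ ℝ 𝓗) (T : 𝓗 →L[ℝ] 𝓗) :
    ‖e.diagPart T‖ ≤ ‖T‖ := by
  refine ContinuousLinearMap.opNorm_le_bound _ (norm_nonneg _) fun x ↦ ?_
  simp only [diagPart, ContinuousLinearMap.comp_apply, ContinuousLinearEquiv.coe_coe,
    LinearIsometryEquiv.coe_toContinuousLinearEquiv, LinearIsometryEquiv.norm_map]
  refine (ContinuousLinearMap.le_of_opNorm_le _ (lp.norm_mapCLM_le _ _ _ _) _).trans_eq ?_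
  rw [LinearIsometryEquiv.norm_map]

theorem HilbertBasis.diagPart_apply_basis (e : HilbertBasis ℕ ℝ 𝓗) (T : 𝓗 →L[ℝ] 𝓗) (n : ℕ) :
    e.diagPart T (e n) = ⟪T (e n), e n⟫ • e n := by
  apply e.repr.injective
  simp only [diagPart, ContinuousLinearMap.comp_apply, ContinuousLinearEquiv.coe_coe,
    LinearIsometryEquiv.coe_toContinuousLinearEquiv, LinearIsometryEquiv.apply_symm_apply,
    map_smul, e.repr_self]
  ext m
  by_cases h : m = n
  · subst h; simp
  · simp [lp.single_apply, h]

theorem HilbertBasis.eq_diagPart (e : HilbertBasis ℕ ℝ 𝓗) {T D : 𝓗 →L[ℝ] 𝓗}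
    (h : ∀ n, D (e n) = ⟪T (e n), e n⟫ • e n) : D = e.diagPart T :=
  e.continuousLinearMap_ext fun n ↦ (h n).trans (e.diagPart_apply_basis T n).symm

theorem HilbertBasis.lipschitzWith_diagPart (e : HilbertBasis ℕ ℝ 𝓗) :
    LipschitzWith 1 e.diagPart := by
  refine LipschitzWith.of_dist_le_mul fun S T ↦ ?_
  rw [dist_eq_norm, dist_eq_norm, NNReal.coe_one, one_mul]
  have h : e.diagPart S - e.diagPart T = e.diagPart (S - T) := e.eq_diagPart fun n ↦ by
    simp [e.diagPart_apply_basis, inner_sub_left, sub_smul]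
  exact h ▸ e.norm_diagPart_le _

theorem HilbertBasis.inner_diagPart (e : HilbertBasis ℕ ℝ 𝓗) (T : 𝓗 →L[ℝ] 𝓗) (x : 𝓗) (n : ℕ) :
    ⟪e.diagPart T x, e n⟫ = ⟪T (e n), e n⟫ * ⟪x, e n⟫ := by
  have h : (innerSL ℝ (e n)) ∘L e.diagPart T = ⟪T (e n), e n⟫ • innerSL ℝ (e n) := by
    refine e.continuousLinearMap_ext fun m ↦ ?_
    by_cases hm : n = m
    · subst hm; simp [e.diagPart_apply_basis]
    · simp [e.diagPart_apply_basis, e.orthonormal.2 hm]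
  have := DFunLike.congr_fun h x
  simpa [real_inner_comm] using this

variable [CompleteSpace 𝓗]

theorem HilbertBasis.star_diagPart (e : HilbertBasis ℕ ℝ 𝓗) (T : 𝓗 →L[ℝ] 𝓗) :
    star (e.diagPart T) = e.diagPart T := by
  refine e.continuousLinearMap_ext fun n ↦ ext_inner_right ℝ fun y ↦ ?_
  rw [ContinuousLinearMap.star_eq_adjoint, ContinuousLinearMap.adjoint_inner_left,
    real_inner_comm, e.inner_diagPart, e.diagPart_apply_basis, real_inner_smul_left,
    real_inner_comm y]

end Diagonal

section HilbertSchmidt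

variable {𝓗 : Type*} [NormedAddCommGroup 𝓗] [InnerProductSpace ℝ 𝓗]

/-- The squared Hilbert–Schmidt norm of a bounded operator, as an extended nonnegative real. -/
noncomputable def HilbertBasis.hsNormSq (e : HilbertBasis ℕ ℝ 𝓗) (T : 𝓗 →L[ℝ] 𝓗) : ENNReal :=
  ∑' n, ENNReal.ofReal (‖T (e n)‖ ^ 2)

theorem HilbertBasis.ofReal_norm_sq_eq_tsum (e : HilbertBasis ℕ ℝ 𝓗) (x : 𝓗) :
    ENNReal.ofReal (‖x‖ ^ 2) = ∑' n, ENNReal.ofReal (⟪e n, x⟫ ^ 2) := by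
  have h := e.hasSum_inner_mul_inner x x
  simp only [real_inner_comm, ← pow_two, real_inner_self_eq_norm_sq] at h
  rw [← h.tsum_eq, ENNReal.ofReal_tsum_of_nonneg (fun n ↦ sq_nonneg _) h.summable]
  simp only [real_inner_comm]

theorem HilbertBasis.summable_and_tsum_eq_of_hsNormSq_eq (e : HilbertBasis ℕ ℝ 𝓗)
    {S T : 𝓗 →L[ℝ] 𝓗} (h : e.hsNormSq S = e.hsNormSq T)
    (hT : Summable fun n ↦ ‖T (e n)‖ ^ 2) :
    (Summable fun n ↦ ‖S (e n)‖ ^ 2) ∧ ∑' n, ‖S (e n)‖ ^ 2 = ∑' n, ‖T (e n)‖ ^ 2 := by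
  have hTfin : e.hsNormSq T = ENNReal.ofReal (∑' n, ‖T (e n)‖ ^ 2) :=
    (ENNReal.ofReal_tsum_of_nonneg (fun n ↦ sq_nonneg _) hT).symm
  have hS : Summable fun n ↦ ‖S (e n)‖ ^ 2 := by
    have := ENNReal.summable_toReal (h.trans hTfin ▸ ENNReal.ofReal_ne_top : e.hsNormSq S ≠ ⊤)
    simpa [ENNReal.toReal_ofReal] using this
  refine ⟨hS, ?_⟩
  rw [hTfin, hsNormSq, ← ENNReal.ofReal_tsum_of_nonneg (fun n ↦ sq_nonneg _) hS] at h
  exact (ENNReal.ofReal_eq_ofReal_iff (tsum_nonneg fun n ↦ sq_nonneg _)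
    (tsum_nonneg fun n ↦ sq_nonneg _)).1 h

variable [CompleteSpace 𝓗]

theorem HilbertBasis.hsNormSq_star (e : HilbertBasis ℕ ℝ 𝓗) (T : 𝓗 →L[ℝ] 𝓗) :
    e.hsNormSq (star T) = e.hsNormSq T := by
  simp only [hsNormSq, e.ofReal_norm_sq_eq_tsum]
  rw [ENNReal.tsum_comm]
  simp only [ContinuousLinearMap.star_eq_adjoint, ContinuousLinearMap.adjoint_inner_right,
    real_inner_comm]

theorem norm_apply_of_star_mul_self {U : 𝓗 →L[ℝ] 𝓗} (hU : star U * U = 1) (x : 𝓗) :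
    ‖U x‖ = ‖x‖ :=
  (U.norm_map_iff_adjoint_comp_self).2 hU x

theorem HilbertBasis.hsNormSq_mul_left (e : HilbertBasis ℕ ℝ 𝓗) {U : 𝓗 →L[ℝ] 𝓗}
    (hU : star U * U = 1) (T : 𝓗 →L[ℝ] 𝓗) : e.hsNormSq (U * T) = e.hsNormSq T := by
  simp only [hsNormSq, mul_apply_eq_comp, norm_apply_of_star_mul_self hU]

theorem HilbertBasis.hsNormSq_conj (e : HilbertBasis ℕ ℝ 𝓗) {U : 𝓗 →L[ℝ] 𝓗}
    (hU : U * star U = 1) (T : 𝓗 →L[ℝ] 𝓗) :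
    e.hsNormSq (star U * T * U) = e.hsNormSq T := by
  have hU' : star (star U) * star U = 1 := by rwa [star_star]
  rw [mul_assoc, e.hsNormSq_mul_left hU', ← e.hsNormSq_star, star_mul, e.hsNormSq_mul_left hU',
    e.hsNormSq_star]

end HilbertSchmidt

section WegnerFlow

variable {𝓗 : Type*} [NormedAddCommGroup 𝓗] [InnerProductSpace ℝ 𝓗]

/-- The generator `[H, diag H]` of the Wegner flow. -/
noncomputable def HilbertBasis.wegnerGenerator (e : HilbertBasis ℕ ℝ 𝓗) (H : 𝓗 →L[ℝ] 𝓗) :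
    𝓗 →L[ℝ] 𝓗 :=
  H * e.diagPart H - e.diagPart H * H

theorem LipschitzOnBalls.wegnerGenerator {E : Type*} [NormedAddCommGroup E]
    (e : HilbertBasis ℕ ℝ 𝓗) {f : E → 𝓗 →L[ℝ] 𝓗} (hf : LipschitzOnBalls f) :
    LipschitzOnBalls fun x ↦ e.wegnerGenerator (f x) :=
  have hd := e.lipschitzWith_diagPart.comp_lipschitzOnBalls hf
  (hf.mul hd).sub (hd.mul hf)

theorem HilbertBasis.lipschitzOnBalls_wegnerField (e : HilbertBasis ℕ ℝ 𝓗) :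
    LipschitzOnBalls fun H : 𝓗 →L[ℝ] 𝓗 ↦
      H * e.wegnerGenerator H - e.wegnerGenerator H * H :=
  have hid : LipschitzOnBalls fun H : 𝓗 →L[ℝ] 𝓗 ↦ H := LipschitzWith.id.lipschitzOnBalls
  have hg := hid.wegnerGenerator e
  (hid.mul hg).sub (hg.mul hid)

variable [CompleteSpace 𝓗]

theorem HilbertBasis.star_wegnerGenerator (e : HilbertBasis ℕ ℝ 𝓗) {H : 𝓗 →L[ℝ] 𝓗}
    (hH : star H = H) : star (e.wegnerGenerator H) = -e.wegnerGenerator H := by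
  rw [wegnerGenerator, star_sub, star_mul, star_mul, e.star_diagPart, hH, neg_sub]

theorem star_conj_of_star_eq {U T : 𝓗 →L[ℝ] 𝓗} (hT : star T = T) :
    star (star U * T * U) = star U * T * U := by
  rw [star_mul, star_mul, star_star, hT, mul_assoc]

theorem lipschitzOnBalls_star_mul_mul (T : 𝓗 →L[ℝ] 𝓗) :
    LipschitzOnBalls fun U : 𝓗 →L[ℝ] 𝓗 ↦ star U * T * U := by
  have hstar : LipschitzOnBalls fun U : 𝓗 →L[ℝ] 𝓗 ↦ star U :=
    (LipschitzWith.of_dist_le_mul (K := 1) fun x y ↦ by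
      rw [dist_eq_norm, dist_eq_norm, ← star_sub, norm_star, NNReal.coe_one,
        one_mul]).lipschitzOnBalls
  exact (hstar.mul (LipschitzWith.const T).lipschitzOnBalls).mul LipschitzWith.id.lipschitzOnBalls

/-- If `W' = W A - A W` with `A` bounded, and `W` equals `1` at time `0`, then `W` is
constantly equal to `1`. -/
theorem eq_one_of_hasDerivAt_commutator {R : Type*} [NormedRing R] [NormedSpace ℝ R]
    {W A : ℝ → R} {M : NNReal} (hA : ∀ t, ‖A t‖ ≤ M)
    (hW : ∀ t, HasDerivAt W (W t * A t - A t * W t) t) (h0 : W 0 = 1) (t : ℝ) : W t = 1 := by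
  have hlip (t : ℝ) : LipschitzWith (2 * M) fun X : R ↦ X * A t - A t * X := by
    refine LipschitzWith.of_dist_le_mul fun X Y ↦ ?_
    rw [dist_eq_norm, dist_eq_norm]
    calc ‖X * A t - A t * X - (Y * A t - A t * Y)‖
        = ‖(X - Y) * A t - A t * (X - Y)‖ := by congr 1; noncomm_ring
      _ ≤ ‖X - Y‖ * ‖A t‖ + ‖A t‖ * ‖X - Y‖ :=
          (norm_sub_le _ _).trans (add_le_add (norm_mul_le _ _) (norm_mul_le _ _))
      _ ≤ ‖X - Y‖ * M + M * ‖X - Y‖ := by grw [hA t]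
      _ = (2 * M : NNReal) * ‖X - Y‖ := by push_cast; ring
  have h := ODE_solution_unique_univ (v := fun t X ↦ X * A t - A t * X) (s := fun _ ↦ univ)
    (g := fun _ ↦ (1 : R)) (t₀ := 0) (fun t ↦ (hlip t).lipschitzOnWith) (fun t ↦ ⟨hW t, trivial⟩)
    (fun t ↦ ⟨by simpa using hasDerivAt_const t (1 : R), trivial⟩) h0
  exact congrFun h t

/-- The orthogonal operators implementing the Wegner flow: `U' = U [H, diag H]` with
`H = U* T U`. -/
theorem HilbertBasis.exists_wegner_orthogonal (e : HilbertBasis ℕ ℝ 𝓗) {T : 𝓗 →L[ℝ] 𝓗}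
    (hT : star T = T) :
    ∃ U : ℝ → 𝓗 →L[ℝ] 𝓗, U 0 = 1 ∧ (∀ t, star (U t) * U t = 1) ∧ (∀ t, U t * star (U t) = 1) ∧
      ∀ t, HasDerivAt U (U t * e.wegnerGenerator (star (U t) * T * U t)) t := by
  set A : (𝓗 →L[ℝ] 𝓗) → 𝓗 →L[ℝ] 𝓗 := fun U ↦ e.wegnerGenerator (star U * T * U) with hAdef
  have hA : LipschitzOnBalls A := (lipschitzOnBalls_star_mul_mul T).wegnerGenerator e
  have hAstar (U) : star (A U) = -A U := e.star_wegnerGenerator (star_conj_of_star_eq hT)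
  have hUA : LipschitzOnBalls fun U ↦ U * A U := LipschitzWith.id.lipschitzOnBalls.mul hA
  obtain ⟨K, L, hK, hL⟩ := hUA.normCutoff_smul
  obtain ⟨U, hU0, hU⟩ := exists_hasDerivAt_of_lipschitzWith_of_bounded hK hL 1
  have hUU (t) : U t * star (U t) = 1 := by
    have hd (t) : HasDerivAt (fun t ↦ U t * star (U t)) 0 t := by
      convert! (hU t).mul (hU t).star using 1
      rw [star_smul, star_mul, hAstar, star_trivial (normCutoff _),
        smul_mul_assoc, mul_smul_comm, ← smul_add,
        mul_assoc, neg_mul, mul_neg, add_neg_cancel, smul_zero]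
    have h := is_const_of_deriv_eq_zero (fun t ↦ (hd t).differentiableAt)
      (fun t ↦ (hd t).deriv) t 0
    simpa [hU0] using h
  have hnorm (t) : ‖U t‖ ≤ 1 := by
    have h1 : ‖U t‖ * ‖U t‖ ≤ 1 := by
      rw [← CStarRing.norm_self_mul_star, hUU]
      exact ContinuousLinearMap.norm_id_le
    nlinarith [norm_nonneg (U t)]
  have hU' (t) : HasDerivAt U (U t * A (U t)) t := by
    simpa [normCutoff_of_norm_le_one (hnorm t)] using hU t
  obtain ⟨M, hM⟩ := hA.exists_bound 1
  refine ⟨U, hU0, fun t ↦ ?_, hUU, hU'⟩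
  refine eq_one_of_hasDerivAt_commutator (W := fun t ↦ star (U t) * U t) (A := fun t ↦ A (U t))
    (fun t ↦ hM _ (by simpa using hnorm t)) (fun t ↦ ?_) (by simp [hU0]) t
  convert! (hU' t).star.mul (hU' t) using 1
  rw [star_mul, hAstar]
  noncomm_ring

theorem HilbertBasis.hasSum_inner_wegnerField (e : HilbertBasis ℕ ℝ 𝓗) {H : 𝓗 →L[ℝ] 𝓗}
    (hH : ∀ x y, ⟪H x, y⟫ = ⟪x, H y⟫) (i : ℕ) :
    HasSum (fun j ↦ 2 * ((⟪H (e i), e i⟫ - ⟪H (e j), e j⟫) * ⟪H (e i), e j⟫ ^ 2))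
      ⟪(H * e.wegnerGenerator H - e.wegnerGenerator H * H) (e i), e i⟫ := by
  have h1 := (e.hasSum_inner_mul_inner (H (e i)) (H (e i))).mul_left ⟪H (e i), e i⟫
  have h2 := e.hasSum_inner_mul_inner (e.diagPart H (H (e i))) (H (e i))
  have hD (x y : 𝓗) : ⟪e.diagPart H x, y⟫ = ⟪x, e.diagPart H y⟫ := by
    rw [← ContinuousLinearMap.adjoint_inner_right, ← ContinuousLinearMap.star_eq_adjoint,
      e.star_diagPart]
  convert! (h1.sub h2).mul_left 2 using 1
  · ext j
    rw [e.inner_diagPart, real_inner_comm (H (e i)) (e j)]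
    ring
  · simp only [wegnerGenerator, mul_apply_eq_comp, sub_apply,
      map_sub, e.diagPart_apply_basis, map_smul, inner_sub_left, hH, hD, real_inner_smul_left,
      real_inner_smul_right]
    ring

end WegnerFlow

/-- Wegner flow in infinite dimension. For every symmetric Hilbert–Schmidt
`H₀` the Cauchy problem `H' = [H, [H, diag(H)]]`, `H(0) = H₀`, where `diag(H)` is the
diagonal part of `H` in the basis `(e_n)`, admits a unique global solution with
`‖H(t)‖_HS = ‖H₀‖_HS` for all `t ≥ 0`, and its diagonal coefficients satisfy
`h_{i,i}'(t) = 2 Σ_j (h_{i,i}(t) − h_{j,j}(t)) |h_{i,j}(t)|²`. -/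
theorem stmt19
    {𝓗 : Type*} [NormedAddCommGroup 𝓗] [InnerProductSpace ℝ 𝓗] [CompleteSpace 𝓗]
    (e : HilbertBasis ℕ ℝ 𝓗)
    (H₀ : 𝓗 →L[ℝ] 𝓗)
    (hH₀sym : ∀ x y, ⟪H₀ x, y⟫ = ⟪x, H₀ y⟫)
    (hH₀HS : Summable fun n => ‖H₀ (e n)‖ ^ 2) :
    ∃ H D : ℝ → 𝓗 →L[ℝ] 𝓗,
      -- `D t = diag(H t)` is the diagonal part of `H t`
      (∀ t : ℝ, ∀ n : ℕ, D t (e n) = (⟪H t (e n), e n⟫ : ℝ) • e n) ∧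
      -- `H` solves the Wegner flow `H' = [H, [H, diag H]]` on `[0,∞)`
      (H 0 = H₀ ∧
        ∀ t ∈ Ici (0 : ℝ),
          HasDerivWithinAt H
            (H t * (H t * D t - D t * H t) - (H t * D t - D t * H t) * H t)
            (Ici 0) t) ∧
      -- `H(t)` is symmetric Hilbert–Schmidt for all `t ≥ 0`
      (∀ t ∈ Ici (0 : ℝ),
        (∀ x y, ⟪H t x, y⟫ = ⟪x, H t y⟫) ∧ Summable fun n => ‖H t (e n)‖ ^ 2) ∧
      -- uniqueness
      (∀ K DK : ℝ → 𝓗 →L[ℝ] 𝓗,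
        ((∀ t : ℝ, ∀ n : ℕ, DK t (e n) = (⟪K t (e n), e n⟫ : ℝ) • e n) ∧
         K 0 = H₀ ∧
         ∀ t ∈ Ici (0 : ℝ),
           HasDerivWithinAt K
             (K t * (K t * DK t - DK t * K t) - (K t * DK t - DK t * K t) * K t)
             (Ici 0) t) →
        ∀ t ∈ Ici (0 : ℝ), K t = H t) ∧
      -- conservation of the Hilbert–Schmidt norm
      (∀ t ∈ Ici (0 : ℝ), (∑' n, ‖H t (e n)‖ ^ 2) = ∑' n, ‖H₀ (e n)‖ ^ 2) ∧
      -- evolution of the diagonal coefficients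
      (∀ i : ℕ, ∀ t ∈ Ici (0 : ℝ),
        HasDerivWithinAt (fun s => (⟪H s (e i), e i⟫ : ℝ))
          (2 * ∑' j : ℕ, (⟪H t (e i), e i⟫ - ⟪H t (e j), e j⟫) *
            (⟪H t (e i), e j⟫ : ℝ) ^ 2)
          (Ici 0) t) := by
  have hT : star H₀ = H₀ := by
    rw [ContinuousLinearMap.star_eq_adjoint, eq_comm, ContinuousLinearMap.eq_adjoint_iff]
    exact hH₀sym
  obtain ⟨U, hU0, hU1, hU2, hU⟩ := e.exists_wegner_orthogonal hT
  set H : ℝ → 𝓗 →L[ℝ] 𝓗 := fun t ↦ star (U t) * H₀ * U t with hHdef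
  have hstar (t) : star (H t) = H t := star_conj_of_star_eq hT
  have hsym (t) (x y) : ⟪H t x, y⟫ = ⟪x, H t y⟫ := by
    rw [← ContinuousLinearMap.adjoint_inner_right, ← ContinuousLinearMap.star_eq_adjoint, hstar]
  have hH0 : H 0 = H₀ := by simp [hHdef, hU0]
  have hderiv (t) : HasDerivAt H
      (H t * e.wegnerGenerator (H t) - e.wegnerGenerator (H t) * H t) t := by
    convert! ((hU t).star.mul_const H₀).mul (hU t) using 1
    rw [star_mul, e.star_wegnerGenerator (hstar t)]
    simp only [hHdef]
    noncomm_ring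
  have hHS (t) := e.summable_and_tsum_eq_of_hsNormSq_eq (e.hsNormSq_conj (hU2 t) H₀) hH₀HS
  refine ⟨H, fun t ↦ e.diagPart (H t), fun t n ↦ e.diagPart_apply_basis _ n,
    ⟨hH0, fun t _ ↦ (hderiv t).hasDerivWithinAt⟩, fun t _ ↦ ⟨hsym t, (hHS t).1⟩, ?_,
    fun t _ ↦ (hHS t).2, fun i t _ ↦ ?_⟩
  · rintro K DK ⟨hDK, hK0, hK⟩
    refine e.lipschitzOnBalls_wegnerField.eq_of_hasDerivWithinAt (fun t ht ↦ ?_)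
      (fun t _ ↦ (hderiv t).hasDerivWithinAt) (hK0.trans hH0.symm)
    simpa only [HilbertBasis.wegnerGenerator, ← e.eq_diagPart (hDK t)] using hK t ht
  · have h := ((hderiv t).clm_apply (hasDerivAt_const t (e i))).inner ℝ (hasDerivAt_const t (e i))
    convert! h.hasDerivWithinAt (s := Ici 0) using 1
    rw [← tsum_mul_left, (e.hasSum_inner_wegnerField (hsym t) i).tsum_eq]
    simp
end
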